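/- arXiv:0902.2467 — 2 statements merged into one kernel-verified Lean document; each statement's English description precedes it below -/
import Mathlib

section
/- Let A be a k-algebra of finite transcendence degree over k which is an integral domain and let n ≥ 0 be an integer. Then the polynomial ring A[n] = A[X_1,...,X_n] is an AF-domain if and only if ht(p[n]) + t.d.(A/p) = t.d.(A) for each prime ideal p of A, where p[n] denotes the extension of p to A[X_1,...,X_n]. -/
open TensorProduct

noncomputable section

/-- Transcendence degree of the `R`-algebra `A` as a cardinal: the supremum of the
cardinalities of algebraically independent subsets of `A` over `R`. -/
def trdegC (R A : Type*) [CommRing R] [CommRing A] [Algebra R A] : Cardinal :=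
  ⨆ s : { s : Set A // AlgebraicIndependent R ((↑) : s → A) }, Cardinal.mk s.1

/-- Transcendence degree of the `R`-algebra `A`, as an extended natural number. -/
def eTrdeg (R A : Type*) [CommRing R] [CommRing A] [Algebra R A] : ℕ∞ :=
  Cardinal.toENat (trdegC R A)

/-- Height of an ideal: the infimum of the heights of the prime ideals containing it,
the height of a prime being taken in the prime spectrum ordered by inclusion. -/
def idealHt {R : Type*} [CommRing R] (I : Ideal R) : ℕ∞ :=
  ⨅ P : { P : PrimeSpectrum R // I ≤ P.asIdeal }, Order.height P.1

/-- The extension `p[n]` of an ideal `p` of `A` to the polynomial ring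
`A[X_1, ..., X_n]`. -/
def polyExt {A : Type*} [CommRing A] (n : ℕ) (p : Ideal A) : Ideal (MvPolynomial (Fin n) A) :=
  p.map (MvPolynomial.C : A →+* MvPolynomial (Fin n) A)

/-- An AF-domain over `k`: a `k`-algebra which is an integral domain such that
`ht p + t.d.(A/p) = t.d.(A)` for every prime ideal `p` of `A`. -/
def IsAFDomain (k A : Type*) [Field k] [CommRing A] [IsDomain A] [Algebra k A] : Prop :=
  ∀ p : Ideal A, p.IsPrime → idealHt p + eTrdeg k (A ⧸ p) = eTrdeg k A

theorem eTrdeg_le_of_injective {k A B : Type} [CommRing k] [CommRing A] [CommRing B] [Algebra k A]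
    [Algebra k B] (f : A →ₐ[k] B) (hf : Function.Injective f) : eTrdeg k A ≤ eTrdeg k B :=
  OrderHomClass.mono Cardinal.toENat (trdeg_le_of_injective f hf)

theorem eTrdeg_eq_of_algEquiv {k A B : Type} [CommRing k] [CommRing A] [CommRing B] [Algebra k A]
    [Algebra k B] (e : A ≃ₐ[k] B) : eTrdeg k A = eTrdeg k B :=
  congrArg Cardinal.toENat e.trdeg_eq

theorem eTrdeg_quotient_comap_le {k A B : Type} [CommRing k] [CommRing A] [CommRing B]
    [Algebra k A] [Algebra k B] (f : A →ₐ[k] B) (P : Ideal B) :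
    eTrdeg k (A ⧸ P.comap f) ≤ eTrdeg k (B ⧸ P) :=
  eTrdeg_le_of_injective (Ideal.quotientMapₐ P f le_rfl) Ideal.quotientMap_injective

theorem eTrdeg_mvPolynomial {k A : Type} [Field k] [CommRing A] [IsDomain A] [Algebra k A]
    (n : ℕ) : eTrdeg k (MvPolynomial (Fin n) A) = eTrdeg k A + n := by
  have h := trdeg_add_eq k A (A := MvPolynomial (Fin n) A)
  rw [MvPolynomial.trdeg_of_isDomain] at h
  change Cardinal.toENat (Algebra.trdeg _ _) = Cardinal.toENat (Algebra.trdeg _ _) + _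
  rw [← h, map_add]
  simp

theorem eTrdeg_polynomial {k A : Type} [Field k] [CommRing A] [IsDomain A] [Algebra k A] :
    eTrdeg k (Polynomial A) = eTrdeg k A + 1 := by
  have h := trdeg_add_eq k A (A := Polynomial A)
  rw [Polynomial.trdeg_of_isDomain] at h
  change Cardinal.toENat (Algebra.trdeg _ _) = Cardinal.toENat (Algebra.trdeg _ _) + _
  rw [← h, map_add]
  simp

theorem eTrdeg_quotient_polyExt {k A : Type} [Field k] [CommRing A] [Algebra k A]
    (n : ℕ) (p : Ideal A) [p.IsPrime] :
    eTrdeg k (MvPolynomial (Fin n) A ⧸ polyExt n p) = eTrdeg k (A ⧸ p) + n := by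
  rw [← eTrdeg_mvPolynomial]
  exact eTrdeg_eq_of_algEquiv
    ((MvPolynomial.quotientEquivQuotientMvPolynomial (σ := Fin n) p).symm.restrictScalars k)

theorem eTrdeg_quotient_map_polynomial_C {k A : Type} [Field k] [CommRing A] [Algebra k A]
    (p : Ideal A) [p.IsPrime] :
    eTrdeg k (Polynomial A ⧸ p.map (Polynomial.C : A →+* Polynomial A)) = eTrdeg k (A ⧸ p) + 1 := by
  rw [← eTrdeg_polynomial]
  refine (eTrdeg_eq_of_algEquiv (AlgEquiv.ofRingEquiv
    (f := Ideal.polynomialQuotientEquivQuotientPolynomial p) fun r ↦ ?_)).symm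
  have h : algebraMap k (Polynomial (A ⧸ p)) r =
      (Polynomial.C (algebraMap k A r)).map (Ideal.Quotient.mk p) := by
    rw [Polynomial.map_C]
    rfl
  rw [h, Ideal.polynomialQuotientEquivQuotientPolynomial_map_mk]
  rfl

theorem idealHt_eq_height {R : Type} [CommRing R] (P : Ideal R) [hP : P.IsPrime] :
    idealHt P = P.height := by
  rw [(⟨P, hP⟩ : PrimeSpectrum R).height_eq_orderHeight]
  exact le_antisymm (iInf_le_of_le ⟨⟨P, hP⟩, le_rfl⟩ le_rfl)
    (le_iInf fun Q ↦ Order.height_mono Q.2)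

/-- The transcendence degree of a domain drops in a nontrivial quotient by a nonzero ideal. -/
theorem eTrdeg_quotient_add_one_le {k A : Type} [Field k] [CommRing A] [IsDomain A] [Algebra k A]
    {q : Ideal A} (hq : q ≠ ⊥) (hq' : q ≠ ⊤) : eTrdeg k (A ⧸ q) + 1 ≤ eTrdeg k A := by
  obtain ⟨x, hxq, hx⟩ := Submodule.exists_mem_ne_zero_of_ne_bot hq
  have := Ideal.Quotient.nontrivial_iff.mpr hq'
  have : Nonempty { s : Set (A ⧸ q) // AlgebraicIndepOn k id s } :=
    ⟨∅, algebraicIndependent_empty_type_iff.mpr (algebraMap k (A ⧸ q)).injective⟩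
  have key : Algebra.trdeg k (A ⧸ q) + 1 ≤ Algebra.trdeg k A := by
    rw [Algebra.trdeg, Cardinal.ciSup_add _ Cardinal.bddAbove_of_small]
    refine ciSup_le' fun s ↦ ?_
    let y : s.1 → A := fun a ↦ Quotient.out a.1
    have hy : (Ideal.Quotient.mkₐ k q) ∘ y = fun a : s.1 ↦ (a : A ⧸ q) := by
      ext a
      exact Quotient.out_eq _
    have hind : AlgebraicIndependent k ((Ideal.Quotient.mkₐ k q) ∘ y) := by
      rw [hy]; exact s.2
    have htr : Transcendental (Algebra.adjoin k (Set.range y)) x := by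
      intro halg
      obtain ⟨⟨r, hr⟩, hr0, hxr⟩ :=
        halg.exists_nonzero_dvd (mem_nonZeroDivisors_of_ne_zero hx)
      rw [Algebra.adjoin_range_eq_range_aeval] at hr
      obtain ⟨f, rfl⟩ := hr
      have hmem := q.mem_of_dvd hxr hxq
      have : MvPolynomial.aeval ((Ideal.Quotient.mkₐ k q) ∘ y) f = 0 := by
        change MvPolynomial.aeval (fun i ↦ Ideal.Quotient.mkₐ k q (y i)) f = 0
        rw [← MvPolynomial.comp_aeval_apply]
        exact Ideal.Quotient.eq_zero_iff_mem.mpr hmem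
      have hf : f = 0 := hind (by simpa using this)
      subst hf
      exact hr0 (by ext; simp)
    have := ((hind.of_comp _).option_iff_transcendental x).mpr htr
    simpa using this.cardinalMk_le_trdeg
  have := OrderHomClass.mono Cardinal.toENat key
  rw [map_add, map_one] at this
  exact this

theorem eTrdeg_quotient_add_one_le_of_lt {k A : Type} [Field k] [CommRing A] [Algebra k A]
    {p q : Ideal A} [p.IsPrime] (hq : q ≠ ⊤) (h : p < q) :
    eTrdeg k (A ⧸ q) + 1 ≤ eTrdeg k (A ⧸ p) := by
  have hne : q.map (Ideal.Quotient.mkₐ k p) ≠ ⊥ := by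
    intro h0
    refine h.not_ge fun x hx ↦ ?_
    have := Ideal.mem_map_of_mem (Ideal.Quotient.mkₐ k p) hx
    rw [h0] at this
    exact Ideal.Quotient.eq_zero_iff_mem.mp (by simpa using this)
  have hne' : q.map (Ideal.Quotient.mkₐ k p) ≠ ⊤ := by
    intro h0
    have := Ideal.comap_map_of_surjective (Ideal.Quotient.mkₐ k p)
      (Ideal.Quotient.mkₐ_surjective k p) q
    rw [h0, Ideal.comap_top] at this
    refine hq (top_le_iff.mp (this.le.trans (sup_le le_rfl fun x hx ↦ h.le ?_)))
    exact Ideal.Quotient.eq_zero_iff_mem.mp hx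
  have := eTrdeg_quotient_add_one_le (k := k) hne hne'
  rwa [eTrdeg_eq_of_algEquiv (DoubleQuot.quotQuotEquivQuotOfLEₐ k h.le)] at this

theorem height_add_eTrdeg_quotient_le {k A : Type} [Field k] [CommRing A] [IsDomain A]
    [Algebra k A] (P : Ideal A) [hP : P.IsPrime] :
    P.height + eTrdeg k (A ⧸ P) ≤ eTrdeg k A := by
  have key (n : ℕ) : ∀ P : PrimeSpectrum A, n ≤ Order.height P →
      n + eTrdeg k (A ⧸ P.asIdeal) ≤ eTrdeg k A := by
    induction n with
    | zero =>
      intro P _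
      rw [Nat.cast_zero, zero_add]
      exact OrderHomClass.mono Cardinal.toENat
        (trdeg_le_of_surjective (Ideal.Quotient.mkₐ k P.asIdeal)
          (Ideal.Quotient.mkₐ_surjective k _))
    | succ n ih =>
      intro P hn
      obtain ⟨s, hs, hlen⟩ := Order.exists_series_of_le_height P hn
      have hlt : s.eraseLast.last < P := by
        rw [← hs]
        exact s.eraseLast_last_rel_last (by omega)
      have hle := Order.length_le_height_last (p := s.eraseLast)
      rw [RelSeries.eraseLast_length, hlen, Nat.add_sub_cancel] at hle
      refine le_trans ?_ (ih _ hle)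
      rw [Nat.cast_add, Nat.cast_one, add_assoc, add_comm 1]
      gcongr
      exact eTrdeg_quotient_add_one_le_of_lt P.2.ne_top hlt
  rw [(⟨P, hP⟩ : PrimeSpectrum A).height_eq_orderHeight]
  generalize hh : Order.height (⟨P, hP⟩ : PrimeSpectrum A) = h
  cases h with
  | coe n => exact key n ⟨P, hP⟩ hh.ge
  | top =>
    have : eTrdeg k A = ⊤ := ENat.eq_top_iff_forall_ge.mpr fun n ↦
      le_trans le_self_add (key n ⟨P, hP⟩ (hh ▸ le_top))
    simp [this]

theorem MvPolynomial.isPrime_map_C {A σ : Type} [CommRing A] (p : Ideal A) [p.IsPrime] :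
    (p.map (MvPolynomial.C : A →+* MvPolynomial σ A)).IsPrime := by
  rw [← Ideal.Quotient.isDomain_iff_prime]
  exact (MvPolynomial.quotientEquivQuotientMvPolynomial (σ := σ) p).symm.toMulEquiv.isDomain _

theorem isPrime_map_of_mvPolynomial_algEquiv {k A B σ : Type} [CommRing k] [CommRing A]
    [CommRing B] [Algebra k A] [Algebra k B] (e : MvPolynomial σ A ≃ₐ[k] B) (f : A →ₐ[k] B)
    (hf : ∀ a, e (MvPolynomial.C a) = f a) (p : Ideal A) [p.IsPrime] : (p.map f).IsPrime := by
  have := MvPolynomial.isPrime_map_C (σ := σ) p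
  have h : p.map f = (p.map MvPolynomial.C).map e.toRingEquiv := by
    rw [← Ideal.map_coe f, ← Ideal.map_coe e.toRingEquiv, Ideal.map_map]
    congr 1
    ext a
    exact (hf a).symm
  rw [h]
  exact Ideal.map_isPrime_of_equiv e.toRingEquiv

theorem comap_map_of_mvPolynomial_algEquiv {k A B σ : Type} [CommRing k] [CommRing A]
    [CommRing B] [Algebra k A] [Algebra k B] (e : MvPolynomial σ A ≃ₐ[k] B) (f : A →ₐ[k] B)
    (hf : ∀ a, e (MvPolynomial.C a) = f a) (p : Ideal A) : (p.map f).comap f = p := by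
  refine le_antisymm (fun x hx ↦ ?_) Ideal.le_comap_map
  let g : B →+* A := MvPolynomial.constantCoeff.comp (e.symm : B →+* MvPolynomial σ A)
  have hg (a : A) : g (f a) = a := by simp [g, ← hf]
  have h := Ideal.mem_map_of_mem g (Ideal.mem_comap.mp hx)
  rw [← Ideal.map_coe f, Ideal.map_map, hg,
    show g.comp (f : A →+* B) = RingHom.id A from RingHom.ext hg, Ideal.map_id] at h
  exact h

/-- Lower bound for heights of primes in a ring `B` isomorphic to a polynomial ring over `A`. -/
theorem height_map_add_eTrdeg_le {k : Type} [Field k] (n : ℕ) :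
    ∀ {A B : Type} [CommRing A] [CommRing B] [Algebra k A] [Algebra k B]
      (e : MvPolynomial (Fin n) A ≃ₐ[k] B) (f : A →ₐ[k] B)
      (_ : ∀ a, e (MvPolynomial.C a) = f a) (P : Ideal B) [P.IsPrime],
      ((P.comap f).map f).height + (eTrdeg k (A ⧸ P.comap f) + n) ≤
        P.height + eTrdeg k (B ⧸ P) := by
  induction n with
  | zero =>
    intro A B _ _ _ _ e f hf P _
    have hsurj : Function.Surjective f := fun b ↦ by
      obtain ⟨a, ha⟩ := MvPolynomial.C_surjective (Fin 0) (e.symm b)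
      exact ⟨a, by rw [← hf, ha, e.apply_symm_apply]⟩
    rw [Ideal.map_comap_of_surjective f hsurj, Nat.cast_zero, add_zero]
    gcongr
    exact eTrdeg_quotient_comap_le f P
  | succ n ih =>
    intro A B _ _ _ _ e f hf P _
    let r := (MvPolynomial.renameEquiv A (finSuccEquiv n)).trans
      (MvPolynomial.optionEquivRight A (Fin n))
    let e' : MvPolynomial (Fin n) (Polynomial A) ≃ₐ[k] B := (r.restrictScalars k).symm.trans e
    let f' : Polynomial A →ₐ[k] B := (e' : MvPolynomial (Fin n) (Polynomial A) →ₐ[k] B).comp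
      (IsScalarTower.toAlgHom k (Polynomial A) (MvPolynomial (Fin n) (Polynomial A)))
    have hf' (a : Polynomial A) : e' (MvPolynomial.C a) = f' a := rfl
    have hC (a : A) : f' (Polynomial.C a) = f a := by
      rw [← hf', ← hf]
      change e (r.symm (MvPolynomial.C (Polynomial.C a))) = _
      congr 1
      rw [AlgEquiv.symm_apply_eq]
      simp [r]
    have hff : (f' : Polynomial A →+* B).comp Polynomial.C = (f : A →+* B) := RingHom.ext hC
    set p := P.comap f with hp
    set Q := P.comap f' with hQ
    have hpQ : p = Q.comap Polynomial.C := by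
      ext a
      simp [hp, hQ, Ideal.mem_comap, hC]
    have hmap : p.map f = (p.map Polynomial.C).map f' := by
      rw [← Ideal.map_coe f, ← hff, ← Ideal.map_map]
      rfl
    have hle : p.map Polynomial.C ≤ Q := Ideal.map_le_iff_le_comap.mpr hpQ.le
    have : p.IsPrime := Ideal.comap_isPrime f P
    have : Q.IsPrime := Ideal.comap_isPrime f' P
    refine le_trans ?_ (ih e' f' hf' P)
    rw [hmap, ← hQ]
    rcases hle.eq_or_lt with heq | hlt
    · rw [heq, ← heq, eTrdeg_quotient_map_polynomial_C, Nat.cast_add, Nat.cast_one,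
        add_assoc (eTrdeg k _), add_comm 1]
    · have := isPrime_map_of_mvPolynomial_algEquiv e' f' hf' Q
      have := isPrime_map_of_mvPolynomial_algEquiv e' f' hf' (p.map Polynomial.C)
      have hlt' : (p.map Polynomial.C).map f' < Q.map f' := by
        refine (Ideal.map_mono hle).lt_of_ne fun h ↦ hlt.ne ?_
        rw [← comap_map_of_mvPolynomial_algEquiv e' f' hf' Q, ← h,
          comap_map_of_mvPolynomial_algEquiv e' f' hf']
      have h1 := Ideal.height_add_one_le_of_lt_of_isPrime hlt'
      have h2 : eTrdeg k (A ⧸ p) ≤ eTrdeg k (Polynomial A ⧸ Q) := by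
        rw [hpQ]
        exact eTrdeg_quotient_comap_le (Polynomial.CAlgHom (R := k) (A := A)) Q
      calc _ = (((p.map Polynomial.C).map f').height + 1) + (eTrdeg k (A ⧸ p) + n) := by
            push_cast
            ring
        _ ≤ _ := by gcongr

/-- For a domain `A` which is a `k`-algebra and `n ≥ 0`, the polynomial ring
`A[n]` is an AF-domain iff `ht (p[n]) + t.d.(A/p) = t.d.(A)` for each prime `p` of `A`. -/
theorem stmt_9 (k A : Type) [Field k] [CommRing A] [IsDomain A] [Algebra k A]
    (hfin : eTrdeg k A ≠ ⊤) (n : ℕ) :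
    IsAFDomain k (MvPolynomial (Fin n) A) ↔
      ∀ p : Ideal A, p.IsPrime →
        idealHt (polyExt n p) + eTrdeg k (A ⧸ p) = eTrdeg k A := by
  let f : A →ₐ[k] MvPolynomial (Fin n) A := IsScalarTower.toAlgHom k A (MvPolynomial (Fin n) A)
  constructor
  · intro h p hp
    have hP : (polyExt n p).IsPrime := MvPolynomial.isPrime_map_C p
    have := h _ hP
    rw [eTrdeg_quotient_polyExt, eTrdeg_mvPolynomial, ← add_assoc] at this
    exact ENat.add_left_injective_of_ne_top (ENat.natCast_ne_top n) this
  · intro h P hP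
    have hp : (P.comap f).IsPrime := Ideal.comap_isPrime f P
    have hpn : (polyExt n (P.comap f)).IsPrime := MvPolynomial.isPrime_map_C _
    have h1 := h _ hp
    rw [idealHt_eq_height] at h1 ⊢
    refine le_antisymm (height_add_eTrdeg_quotient_le P) ?_
    rw [eTrdeg_mvPolynomial, ← h1, add_assoc]
    exact height_map_add_eTrdeg_le n AlgEquiv.refl f (fun _ ↦ rfl) P
end
end

section
/- Let T be a k-algebra of finite transcendence degree over k which is an integral domain, M a maximal ideal of T, K = T/M, φ : T → K the canonical surjection, D a subring of K, and A := φ^{-1}(D). Assume T and D are AF-domains and the localization T_M is catenarian. Let B be an arbitrary k-algebra of finite transcendence degree over k, P a prime ideal of A⊗_kB, p = P∩A and q = P∩B. If M ⊄ p, then ht(P) = ht(p) + ht(q[t.d.(A)]) + ht(P/(p⊗_kB + A⊗_kq)), where q[t.d.(A)] denotes the extension of q to the polynomial ring B[X_1,...,X_{t.d.(A)}]. -/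
open TensorProduct

noncomputable section

/-- A catenarian domain: `ht p + ht (q/p) = ht q` for all primes `p ⊆ q`. -/
def IsCatenarian (R : Type*) [CommRing R] : Prop :=
  ∀ p q : Ideal R, p.IsPrime → q.IsPrime → p ≤ q →
    idealHt p + idealHt (q.map (Ideal.Quotient.mk p)) = idealHt q

universe u

lemma exists_lt_of_succ_le_height {α : Type*} [Preorder α] {a : α} {m : ℕ}
    (h : ((m + 1 : ℕ) : ℕ∞) ≤ Order.height a) : ∃ b < a, (m : ℕ∞) ≤ Order.height b := by
  by_contra! hc
  have := h.trans (Order.height_le_coe_iff.2 hc)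
  norm_cast at this
  omega

/-- Heights do not increase along a map with the going-down property. -/
lemma height_le_of_goingDown {α β : Type*} [PartialOrder α] [PartialOrder β] (f : α → β)
    (hf : ∀ a, ∀ b ≤ f a, ∃ a' ≤ a, f a' = b) (a : α) :
    Order.height (f a) ≤ Order.height a := by
  refine ENat.forall_natCast_le_iff_le.1 fun m ↦ ?_
  induction m generalizing a with
  | zero => simp
  | succ m ih =>
    intro h
    obtain ⟨b, hb, hm⟩ := exists_lt_of_succ_le_height h
    obtain ⟨a', ha', rfl⟩ := hf a b hb.le
    have hlt : a' < a := lt_of_le_of_ne ha' (by rintro rfl; exact hb.ne rfl)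
    calc ((m + 1 : ℕ) : ℕ∞) = m + 1 := by push_cast; rfl
      _ ≤ Order.height a' + 1 := by gcongr; exact ih a' hm
      _ ≤ Order.height a := Order.height_add_one_le hlt

/-- A strictly monotone map sends a chain below `a` to a chain between the image of
some `a₀ ≤ a` and the image of `a`. -/
lemma exists_le_add_height_le_of_strictMono {α β : Type*} [PartialOrder α] [PartialOrder β]
    {f : α → β} (hf : StrictMono f) (m : ℕ) (a : α) (h : (m : ℕ∞) ≤ Order.height a) :
    ∃ a₀ ≤ a, m + Order.height (f a₀) ≤ Order.height (f a) := by
  induction m generalizing a with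
  | zero => exact ⟨a, le_rfl, by simp⟩
  | succ m ih =>
    obtain ⟨b, hb, hm⟩ := exists_lt_of_succ_le_height h
    obtain ⟨a₀, ha₀, hle⟩ := ih b hm
    refine ⟨a₀, ha₀.trans hb.le, ?_⟩
    calc ((m + 1 : ℕ) : ℕ∞) + Order.height (f a₀) = m + Order.height (f a₀) + 1 := by
          push_cast; ring
      _ ≤ Order.height (f b) + 1 := by gcongr
      _ ≤ Order.height (f a) := Order.height_add_one_le (hf hb)

lemma natCast_le_eTrdeg_iff {R A : Type u} [CommRing R] [CommRing A] [Algebra R A]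
    [Nontrivial R] [FaithfulSMul R A] {m : ℕ} :
    (m : ℕ∞) ≤ eTrdeg R A ↔ ∃ y : Fin m → A, AlgebraicIndependent R y := by
  rw [eTrdeg, Cardinal.natCast_le_toENat]
  constructor
  · intro h
    cases m with
    | zero =>
      exact ⟨Fin.elim0, algebraicIndependent_empty_type_iff.2 (FaithfulSMul.algebraMap_injective R A)⟩
    | succ m =>
      have hlt : (m : Cardinal.{u}) < trdegC R A :=
        lt_of_lt_of_le (by exact_mod_cast Nat.lt_succ_self m) h
      obtain ⟨s, hs⟩ := exists_lt_of_lt_ciSup' hlt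
      have hle : ((m + 1 : ℕ) : Cardinal.{u}) ≤ Cardinal.mk s.1 := by
        rw [Nat.cast_succ]; exact Cardinal.natCast_add_one_le_iff.2 hs
      have hle' : Cardinal.lift.{u} (Cardinal.mk (Fin (m + 1))) ≤
          Cardinal.lift.{0} (Cardinal.mk s.1) := by simpa using hle
      obtain ⟨e⟩ := Cardinal.lift_mk_le'.1 hle'
      exact ⟨_, s.2.comp e e.injective⟩
  · rintro ⟨y, hy⟩
    have hle : Cardinal.mk (Set.range y) ≤ trdegC R A :=
      le_ciSup (f := fun s : { s : Set A // AlgebraicIndependent R ((↑) : s → A) } ↦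
        Cardinal.mk s.1) Cardinal.bddAbove_of_small ⟨Set.range y, hy.coe_range⟩
    have : Cardinal.lift.{0} (Cardinal.mk (Set.range y)) =
        Cardinal.lift.{u} (Cardinal.mk (Fin m)) := Cardinal.mk_range_eq_of_injective hy.injective
    simp only [Cardinal.lift_uzero, Cardinal.mk_fin, Cardinal.lift_natCast] at this
    rwa [this] at hle

lemma algebraicIndependent_range_iff {B C : Type u} [CommRing B] [CommRing C] {f : B →+* C}
    {ι : Type*} {y : ι → C} :
    AlgebraicIndependent f.range y ↔
      ∀ g : MvPolynomial ι B, MvPolynomial.eval₂ f y g = 0 → MvPolynomial.map f g = 0 := by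
  have hinj : Function.Injective (MvPolynomial.map (σ := ι) f.range.subtype) :=
    MvPolynomial.map_injective _ Subtype.val_injective
  have hsurj : Function.Surjective (MvPolynomial.map (σ := ι) f.rangeRestrict) :=
    MvPolynomial.map_surjective _ f.rangeRestrict_surjective
  rw [algebraicIndependent_iff, hsurj.forall]
  refine forall_congr' fun g ↦ ?_
  have h1 : MvPolynomial.aeval y (MvPolynomial.map f.rangeRestrict g) =
      MvPolynomial.eval₂ f y g := by
    rw [MvPolynomial.aeval_def, MvPolynomial.eval₂_map]
    rfl
  rw [h1, ← map_eq_zero_iff _ hinj, MvPolynomial.map_map]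
  rfl

lemma MvPolynomial.map_eq_zero_iff_coeff {B C ι : Type*} [CommRing B] [CommRing C] (f : B →+* C)
    (g : MvPolynomial ι B) : MvPolynomial.map f g = 0 ↔ ∀ d, f (g.coeff d) = 0 := by
  simp [MvPolynomial.ext_iff, MvPolynomial.coeff_map]

/-- The relative transcendence degree drops in a proper quotient with the same base ring. -/
lemma eTrdeg_range_add_one_le {B C' C : Type u} [CommRing B] [CommRing C'] [IsDomain C']
    [CommRing C] [IsDomain C] (f : B →+* C') (σ : C' →+* C) (hσ : Function.Surjective σ)
    (hinj : ¬ Function.Injective σ) (hker : RingHom.ker (σ.comp f) ≤ RingHom.ker f) :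
    eTrdeg (σ.comp f).range C + 1 ≤ eTrdeg f.range C' := by
  have key : ∀ m : ℕ, (m : ℕ∞) ≤ eTrdeg (σ.comp f).range C →
      ((m + 1 : ℕ) : ℕ∞) ≤ eTrdeg f.range C' := by
    intro m hm
    obtain ⟨y, hy⟩ := natCast_le_eTrdeg_iff.1 hm
    obtain ⟨z, rfl⟩ : ∃ z : Fin m → C', y = σ ∘ z :=
      ⟨fun i ↦ (hσ (y i)).choose, funext fun i ↦ (hσ (y i)).choose_spec.symm⟩
    rw [algebraicIndependent_range_iff] at hy
    have hz' : ∀ g : MvPolynomial (Fin m) B, σ (MvPolynomial.eval₂ f z g) = 0 →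
        MvPolynomial.map f g = 0 := by
      intro g hg
      rw [MvPolynomial.map_eq_zero_iff_coeff]
      intro d
      refine hker ((MvPolynomial.map_eq_zero_iff_coeff _ _).1 (hy g ?_) d)
      rw [← hg, MvPolynomial.eval₂_comp_left]
    have hz : AlgebraicIndependent f.range z :=
      algebraicIndependent_range_iff.2 fun g hg ↦ hz' g (by rw [hg, map_zero])
    obtain ⟨c, hc, hc0⟩ : ∃ c, σ c = 0 ∧ c ≠ 0 := by
      by_contra! h
      exact hinj ((injective_iff_map_eq_zero σ).2 h)
    have htr : Transcendental (Algebra.adjoin f.range (Set.range z)) c := by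
      intro halg
      refine Ideal.comap_ne_bot_of_algebraic_mem hc0 (I := RingHom.ker σ) hc halg ?_
      rw [eq_bot_iff]
      rintro ⟨a, ha⟩ haσ
      have haσ' : σ a = 0 := haσ
      have ha' := ha
      rw [Algebra.adjoin_range_eq_range_aeval] at ha'
      obtain ⟨q, rfl⟩ := ha'
      obtain ⟨g, rfl⟩ := MvPolynomial.map_surjective _ f.rangeRestrict_surjective q
      have h1 : MvPolynomial.aeval z (MvPolynomial.map f.rangeRestrict g) =
          MvPolynomial.eval₂ f z g := by
        rw [MvPolynomial.aeval_def, MvPolynomial.eval₂_map]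
        rfl
      have h2 : MvPolynomial.map f.rangeRestrict g = 0 := by
        rw [← map_eq_zero_iff _ (MvPolynomial.map_injective f.range.subtype Subtype.val_injective),
          MvPolynomial.map_map]
        exact hz' g (by rw [← h1]; exact haσ')
      simp only [Ideal.mem_bot]
      ext
      change MvPolynomial.aeval z (MvPolynomial.map f.rangeRestrict g) = 0
      rw [h2, map_zero]
    have hopt := (hz.option_iff_transcendental c).2 htr
    exact natCast_le_eTrdeg_iff.2 ⟨_, hopt.comp (finSuccEquiv m) (finSuccEquiv m).injective⟩
  cases h : eTrdeg (σ.comp f).range C with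
  | top =>
    rw [h] at key
    rw [top_add, top_le_iff]
    exact ENat.eq_top_iff_forall_ge.2 fun m ↦ le_trans (by norm_cast; omega) (key m le_top)
  | coe m =>
    exact_mod_cast key m h.ge

section padEval

variable {B C ι : Type u} [CommRing B] [CommRing C] [DecidableEq ι]

/-- Evaluate the variables in `S` at `y` and keep the other ones. -/
def padEval (f : B →+* C) (y : ι → C) (S : Finset ι) : MvPolynomial ι B →+* MvPolynomial ι C :=
  MvPolynomial.eval₂Hom (MvPolynomial.C.comp f)
    (fun i ↦ if i ∈ S then MvPolynomial.C (y i) else MvPolynomial.X i)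

lemma padEval_empty (f : B →+* C) (y : ι → C) : padEval f y ∅ = MvPolynomial.map f := by
  ext i : 2 <;> simp [padEval]

lemma ker_padEval_le_insert (f : B →+* C) (y : ι → C) (S : Finset ι) (i : ι) :
    RingHom.ker (padEval f y S) ≤ RingHom.ker (padEval f y (insert i S)) := by
  have : padEval f y (insert i S) = ((MvPolynomial.aeval (R := C) fun j ↦
      if j = i then MvPolynomial.C (y i) else MvPolynomial.X j :
      MvPolynomial ι C →ₐ[C] MvPolynomial ι C) : MvPolynomial ι C →+* MvPolynomial ι C).comp
        (padEval f y S) := by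
    refine MvPolynomial.ringHom_ext (fun b ↦ ?_) fun j ↦ ?_
    · simp [padEval]
    · by_cases hj : j ∈ S <;> by_cases hi : j = i <;> simp [padEval, hj, hi]
      · subst hi; simp [hj]
      · subst hi; simp [hj]
  rw [this]
  exact fun g hg ↦ by rw [RingHom.mem_ker] at hg ⊢; rw [RingHom.comp_apply, hg, map_zero]

lemma padEval_comp {D : Type u} [CommRing D] (f : B →+* C) (y : ι → C) (S : Finset ι)
    (σ : C →+* D) :
    padEval (σ.comp f) (σ ∘ y) S = (MvPolynomial.map σ).comp (padEval f y S) := by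
  refine MvPolynomial.ringHom_ext (fun b ↦ ?_) fun j ↦ ?_
  · simp [padEval]
  · by_cases hj : j ∈ S <;> simp [padEval, hj]

lemma algebraicIndependent_iff_ker_padEval_le (f : B →+* C) (y : ι → C) (S : Finset ι) :
    AlgebraicIndependent f.range (fun i : S ↦ y i) ↔
      RingHom.ker (padEval f y S) ≤ RingHom.ker (MvPolynomial.map (σ := ι) f) := by
  constructor
  · intro h g hg
    have hX : AlgebraicIndependent C (fun i : {i // ¬ i ∈ S} ↦ (MvPolynomial.X i : MvPolynomial ι C)) :=
      (MvPolynomial.algebraicIndependent_X ι C).comp _ Subtype.val_injective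
    have hs := h.sumElim_comp hX
    have hc : AlgebraicIndependent f.range (fun i ↦ if i ∈ S then MvPolynomial.C (y i) else
        (MvPolynomial.X i : MvPolynomial ι C)) := by
      refine (algebraicIndependent_equiv' ((Equiv.sumComm _ _).trans
        (Equiv.sumCompl (· ∈ S))) ?_).1 hs
      ext1 i
      rcases i with i | i <;> simp [i.2, MvPolynomial.algebraMap_eq]
    rw [algebraicIndependent_iff] at hc
    have := hc (MvPolynomial.map f.rangeRestrict g) (by
      rw [MvPolynomial.aeval_def, MvPolynomial.eval₂_map]
      exact hg)
    rw [RingHom.mem_ker, show f = f.range.subtype.comp f.rangeRestrict from rfl,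
      ← MvPolynomial.map_map, this, map_zero]
  · intro h
    rw [algebraicIndependent_range_iff]
    intro g hg
    have h1 : padEval f y S (MvPolynomial.rename Subtype.val g) = 0 := by
      rw [padEval, MvPolynomial.coe_eval₂Hom, MvPolynomial.eval₂_rename]
      have h2 : ((fun i ↦ if i ∈ S then MvPolynomial.C (y i) else
        (MvPolynomial.X i : MvPolynomial ι C)) ∘ ((↑) : S → ι)) =
          MvPolynomial.C ∘ (fun i : S ↦ y i) := by
        ext1 i; simp
      rw [h2]
      have := MvPolynomial.eval₂_comp_left (MvPolynomial.C (σ := ι)) f (fun i : S ↦ y i) g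
      rw [← this, hg, map_zero]
    have h3 := h h1
    rw [RingHom.mem_ker, MvPolynomial.map_rename] at h3
    exact (map_eq_zero_iff _ (MvPolynomial.rename_injective _ Subtype.val_injective)).1 h3

end padEval

/-- The kernel of a ring homomorphism to a domain, as a point of the spectrum. -/
def kerPoint {X Y : Type*} [CommRing X] [CommRing Y] [IsDomain Y] (φ : X →+* Y) :
    PrimeSpectrum X :=
  ⟨RingHom.ker φ, RingHom.ker_isPrime φ⟩

/-- Adjoining a dependent value strictly enlarges the kernel, so the kernel of the partial
evaluation at `S` has height at least that of the extension of `ker f` plus the number of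
elements of `S` minus the transcendence degree. -/
lemma height_kerPoint_map_add_card_le {B C ι : Type u} [CommRing B] [CommRing C] [IsDomain C]
    [DecidableEq ι] (f : B →+* C) (y : ι → C) (S : Finset ι) :
    Order.height (kerPoint (MvPolynomial.map (σ := ι) f)) + S.card ≤
      Order.height (kerPoint (padEval f y S)) + eTrdeg f.range C := by
  classical
  obtain ⟨S₀, hS₀, hmax⟩ := Finset.exists_max_image (S.powerset.filter fun T : Finset ι ↦
    AlgebraicIndependent f.range (fun i : T ↦ y i)) Finset.card
    ⟨∅, by
      simp only [Finset.mem_filter, Finset.empty_mem_powerset, true_and]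
      rw [algebraicIndependent_iff_ker_padEval_le, padEval_empty]⟩
  rw [Finset.mem_filter, Finset.mem_powerset] at hS₀
  obtain ⟨hS₀S, hind⟩ := hS₀
  have hker := (algebraicIndependent_iff_ker_padEval_le f y S₀).1 hind
  have hker' : ∀ T : Finset ι, RingHom.ker (MvPolynomial.map (σ := ι) f) ≤
      RingHom.ker (padEval f y T) := by
    intro T
    induction T using Finset.induction with
    | empty => rw [padEval_empty]
    | insert i T _ ih => exact ih.trans (ker_padEval_le_insert f y T i)
  have hS₀pt : kerPoint (padEval f y S₀) = kerPoint (MvPolynomial.map (σ := ι) f) :=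
    PrimeSpectrum.ext (le_antisymm hker (hker' S₀))
  have hcard : (S₀.card : ℕ∞) ≤ eTrdeg f.range C :=
    natCast_le_eTrdeg_iff.2 ⟨_, hind.comp S₀.equivFin.symm S₀.equivFin.symm.injective⟩
  have hchain : ∀ U : Finset ι, U ⊆ S → Disjoint S₀ U →
      Order.height (kerPoint (padEval f y S₀)) + U.card ≤
        Order.height (kerPoint (padEval f y (S₀ ∪ U))) := by
    intro U
    induction U using Finset.induction with
    | empty => intro _ _; simp
    | insert i U hi ih =>
      intro hUS hdisj
      rw [Finset.insert_subset_iff] at hUS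
      rw [Finset.disjoint_insert_right] at hdisj
      have hlt : kerPoint (padEval f y (S₀ ∪ U)) < kerPoint (padEval f y (insert i (S₀ ∪ U))) := by
        refine lt_of_le_of_ne (ker_padEval_le_insert f y _ i) fun heq ↦ ?_
        have heq' : RingHom.ker (padEval f y (S₀ ∪ U)) =
            RingHom.ker (padEval f y (insert i (S₀ ∪ U))) := congrArg PrimeSpectrum.asIdeal heq
        have hins : AlgebraicIndependent f.range (fun j : (insert i S₀ : Finset ι) ↦ y j) := by
          rw [algebraicIndependent_range_iff]
          intro g hg
          have h1 : padEval f y (insert i (S₀ ∪ U)) (MvPolynomial.rename Subtype.val g) = 0 := by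
            rw [padEval, MvPolynomial.coe_eval₂Hom, MvPolynomial.eval₂_rename]
            have h2 : ((fun j ↦ if j ∈ insert i (S₀ ∪ U) then MvPolynomial.C (y j) else
              (MvPolynomial.X j : MvPolynomial ι C)) ∘ (Subtype.val : ↥(insert i S₀) → ι)) =
                MvPolynomial.C ∘ (fun j : (insert i S₀ : Finset ι) ↦ y j) := by
              ext1 j
              have := j.2
              simp only [Finset.mem_insert] at this
              simp only [Function.comp_apply, Finset.mem_insert, Finset.mem_union]
              rw [if_pos (by tauto)]
            rw [h2]
            have := MvPolynomial.eval₂_comp_left (MvPolynomial.C (σ := ι)) f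
              (fun j : (insert i S₀ : Finset ι) ↦ y j) g
            rw [← this, hg, map_zero]
          have h3 : padEval f y (S₀ ∪ U) (MvPolynomial.rename Subtype.val g) = 0 := by
            rw [← RingHom.mem_ker, heq']
            exact h1
          have h4 : padEval f y S₀ (MvPolynomial.rename Subtype.val g) = 0 := by
            rw [← h3, padEval, padEval, MvPolynomial.coe_eval₂Hom, MvPolynomial.coe_eval₂Hom,
              MvPolynomial.eval₂_rename, MvPolynomial.eval₂_rename]
            congr 1
            ext1 j
            have hj := j.2
            simp only [Finset.mem_insert] at hj
            simp only [Function.comp_apply, Finset.mem_union]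
            rcases hj with hj | hj
            · rw [if_neg (by rw [hj]; exact hdisj.1), if_neg (by rw [hj]; tauto)]
            · rw [if_pos hj, if_pos (Or.inl hj)]
          have h5 := hker h4
          rw [RingHom.mem_ker, MvPolynomial.map_rename] at h5
          exact (map_eq_zero_iff _ (MvPolynomial.rename_injective _ Subtype.val_injective)).1 h5
        have := hmax (insert i S₀) (by
          rw [Finset.mem_filter, Finset.mem_powerset]
          exact ⟨Finset.insert_subset hUS.1 hS₀S, hins⟩)
        rw [Finset.card_insert_of_notMem hdisj.1] at this
        omega
      rw [Finset.union_insert, Finset.card_insert_of_notMem hi, Nat.cast_succ, ← add_assoc]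
      exact (add_le_add_left (ih hUS.2 hdisj.2) 1).trans (Order.height_add_one_le hlt)
  have h := hchain (S \ S₀) Finset.sdiff_subset Finset.disjoint_sdiff
  rw [Finset.union_sdiff_of_subset hS₀S, hS₀pt] at h
  rw [← Finset.card_sdiff_add_card_eq_card hS₀S, Nat.cast_add, ← add_assoc]
  exact add_le_add h hcard

/-- The height of the extension of the kernel of `f` to the polynomial ring in `n` variables. -/
def extHeight {B C : Type*} [CommRing B] [CommRing C] [IsDomain C] (n : ℕ) (f : B →+* C) : ℕ∞ :=
  Order.height (kerPoint (MvPolynomial.map (σ := Fin n) f))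

lemma extHeight_congr {B C C' : Type*} [CommRing B] [CommRing C] [IsDomain C] [CommRing C']
    [IsDomain C'] (n : ℕ) (f : B →+* C) (f' : B →+* C') (h : RingHom.ker f = RingHom.ker f') :
    extHeight n f = extHeight n f' := by
  rw [extHeight, extHeight]
  congr 1
  refine PrimeSpectrum.ext ?_
  simp only [kerPoint, MvPolynomial.ker_map, h]

lemma extHeight_add_le {B C' C : Type} [CommRing B] [CommRing C'] [IsDomain C'] [CommRing C]
    [IsDomain C] (f : B →+* C') (σ : C' →+* C) {r n : ℕ} (hrn : r ≤ n) (y : Fin r → C')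
    (hy : AlgebraicIndependent (σ.comp f).range (σ ∘ y)) (b : B) (hb : σ (f b) = 0)
    (hb' : f b ≠ 0) :
    extHeight n f + r + 1 ≤ extHeight n (σ.comp f) + eTrdeg f.range C' := by
  let z : Fin n → C' := fun i ↦ if h : i.1 < r then y ⟨i, h⟩ else 0
  let S : Finset (Fin n) := Finset.univ.map (Fin.castLEEmb hrn)
  have hS : S.card = r := by simp [S]
  have hmem : ∀ i : S, i.1.1 < r := by
    rintro ⟨i, hi⟩
    simp only [S, Finset.mem_map, Finset.mem_univ, true_and] at hi
    obtain ⟨j, rfl⟩ := hi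
    exact j.2
  have hind : AlgebraicIndependent (σ.comp f).range (fun i : S ↦ (σ ∘ z) i) := by
    have hinj : Function.Injective fun i : S ↦ (⟨i.1.1, hmem i⟩ : Fin r) := by
      intro i j hij
      simp only [Fin.mk.injEq] at hij
      exact Subtype.ext (Fin.ext hij)
    convert hy.comp _ hinj using 1
    ext1 i
    simp [z, hmem i]
  rw [algebraicIndependent_iff_ker_padEval_le, padEval_comp] at hind
  have hlt : kerPoint (padEval f z S) < kerPoint (MvPolynomial.map (σ := Fin n) (σ.comp f)) := by
    refine lt_of_le_of_ne (fun g hg ↦ hind ?_) fun heq ↦ ?_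
    · have hg' : padEval f z S g = 0 := hg
      rw [RingHom.mem_ker, RingHom.comp_apply, hg', map_zero]
    · have h1 : MvPolynomial.C b ∈ RingHom.ker (padEval f z S) := by
        change MvPolynomial.C b ∈ (kerPoint (padEval f z S)).asIdeal
        rw [heq]
        change _ = _
        simp [hb]
      rw [RingHom.mem_ker, padEval, MvPolynomial.coe_eval₂Hom, MvPolynomial.eval₂_C] at h1
      exact hb' (MvPolynomial.C_injective (Fin n) _ (by simpa using h1))
  have h1 := height_kerPoint_map_add_card_le f z S
  have h2 := Order.height_add_one_le hlt
  rw [hS] at h1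
  calc extHeight n f + r + 1 ≤
      (Order.height (kerPoint (padEval f z S)) + eTrdeg f.range C') + 1 := add_le_add_left h1 1
    _ = (Order.height (kerPoint (padEval f z S)) + 1) + eTrdeg f.range C' := by ring
    _ ≤ _ := by gcongr; exact h2

section TensorProduct

variable {k R B : Type} [Field k] [CommRing R] [Algebra k R] [CommRing B] [Algebra k B]

/-- A ring generated by the image of `R` over the image of `B` has a transcendence basis coming
from `R`. -/
lemma exists_algebraicIndependent_of_le_eTrdeg {C : Type} [CommRing C] [IsDomain C]
    (ψ : R ⊗[k] B →+* C) (hψ : Function.Surjective ψ) (f : B →+* C)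
    (hf : ∀ b, f b = ψ (1 ⊗ₜ b)) {m : ℕ} (hm : (m : ℕ∞) ≤ eTrdeg f.range C) :
    ∃ z : Fin m → R, AlgebraicIndependent f.range (fun i ↦ ψ (z i ⊗ₜ 1)) := by
  let s : Set C := Set.range fun r : R ↦ ψ (r ⊗ₜ 1)
  have htop : ∀ c : C, c ∈ Algebra.adjoin f.range s := by
    intro c
    obtain ⟨t, rfl⟩ := hψ c
    induction t with
    | zero => rw [map_zero]; exact zero_mem _
    | add x y hx hy => rw [map_add]; exact add_mem hx hy
    | tmul r b =>
      have : ψ (r ⊗ₜ b) = ψ (r ⊗ₜ 1) * f b := by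
        rw [hf, ← map_mul, Algebra.TensorProduct.tmul_mul_tmul, mul_one, one_mul]
      rw [this]
      exact mul_mem (Algebra.subset_adjoin ⟨r, rfl⟩)
        (Subalgebra.algebraMap_mem _ (⟨f b, b, rfl⟩ : f.range))
  have : Algebra.IsAlgebraic (Algebra.adjoin f.range s) C :=
    ⟨fun c ↦ isAlgebraic_algebraMap (⟨c, htop c⟩ : Algebra.adjoin f.range s)⟩
  obtain ⟨t, hts, ht⟩ := exists_isTranscendenceBasis_subset (R := f.range) s
  have hcard : Cardinal.mk t = trdegC f.range C := ht.cardinalMk_eq_trdeg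
  rw [eTrdeg, Cardinal.natCast_le_toENat, ← hcard] at hm
  have hle : Cardinal.mk (Fin m) ≤ Cardinal.mk t := by simpa using hm
  obtain ⟨e⟩ := hle
  have h : ∀ i, ∃ r : R, ψ (r ⊗ₜ 1) = e i := fun i ↦ hts (e i).2
  choose z hz using h
  refine ⟨z, ?_⟩
  simp only [hz]
  exact ht.1.comp e e.injective

lemma algebraicIndependent_of_tensorProduct {C : Type} [CommRing C] [Nontrivial C]
    (ψ : R ⊗[k] B →+* C) (f : B →+* C) (hf : ∀ b, f b = ψ (1 ⊗ₜ b)) {ι : Type} (z : ι → R)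
    (hz : AlgebraicIndependent f.range (fun i ↦ ψ (z i ⊗ₜ 1))) : AlgebraicIndependent k z := by
  rw [algebraicIndependent_range_iff] at hz
  rw [algebraicIndependent_iff]
  intro g hg
  have hcomp : f.comp (algebraMap k B) =
      (ψ.comp (Algebra.TensorProduct.includeLeftRingHom)).comp (algebraMap k R) := by
    ext c
    simp [hf, Algebra.algebraMap_eq_smul_one,
      TensorProduct.smul_tmul]
  have h1 := hz (MvPolynomial.map (algebraMap k B) g) (by
    rw [MvPolynomial.eval₂_map, hcomp]
    have := MvPolynomial.eval₂_comp_left (ψ.comp (Algebra.TensorProduct.includeLeftRingHom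
      (R := k) (A := R) (B := B))) (algebraMap k R) z g
    rw [← MvPolynomial.aeval_def, hg, map_zero] at this
    exact this.symm)
  rw [MvPolynomial.map_map] at h1
  exact (map_eq_zero_iff _ (MvPolynomial.map_injective _ (f.comp (algebraMap k B)).injective)).1 h1

/-- The map from `B` to the residue ring of a prime of `R ⊗[k] B`. -/
def baseMap (P : PrimeSpectrum (R ⊗[k] B)) : B →+* (R ⊗[k] B) ⧸ P.asIdeal :=
  (Ideal.Quotient.mk P.asIdeal).comp
    (Algebra.TensorProduct.includeRight : B →ₐ[k] R ⊗[k] B).toRingHom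

/-- The relative transcendence degree of the residue ring of a prime of `R ⊗[k] B`. -/
def residueTrdeg (P : PrimeSpectrum (R ⊗[k] B)) : ℕ∞ :=
  eTrdeg (baseMap P).range ((R ⊗[k] B) ⧸ P.asIdeal)

lemma residueTrdeg_le [Nontrivial R] (P : PrimeSpectrum (R ⊗[k] B)) :
    residueTrdeg P ≤ eTrdeg k R := by
  refine ENat.forall_natCast_le_iff_le.1 fun m hm ↦ ?_
  obtain ⟨z, hz⟩ := exists_algebraicIndependent_of_le_eTrdeg (Ideal.Quotient.mk P.asIdeal)
    Ideal.Quotient.mk_surjective (baseMap P) (fun _ ↦ rfl) hm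
  exact natCast_le_eTrdeg_iff.2 ⟨z, algebraicIndependent_of_tensorProduct _ _ (fun _ ↦ rfl) z hz⟩

lemma height_add_residueTrdeg_le [Nontrivial R] {n : ℕ} (hn : eTrdeg k R ≤ n)
    (P : PrimeSpectrum (R ⊗[k] B)) :
    Order.height P + residueTrdeg P ≤ n + extHeight n (baseMap P) := by
  have key : ∀ (m : ℕ) (P : PrimeSpectrum (R ⊗[k] B)), (m : ℕ∞) ≤ Order.height P →
      m + residueTrdeg P ≤ n + extHeight n (baseMap P) := by
    intro m
    induction m with
    | zero =>
      intro P _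
      rw [Nat.cast_zero, zero_add]
      exact ((residueTrdeg_le P).trans hn).trans le_self_add
    | succ m ih =>
      intro P hm
      obtain ⟨P', hlt, hm'⟩ := exists_lt_of_succ_le_height hm
      have hP' := ih P' hm'
      have hfin : ∀ P : PrimeSpectrum (R ⊗[k] B), residueTrdeg P ≠ ⊤ := fun P ↦
        ne_top_of_le_ne_top (ENat.natCast_ne_top n) ((residueTrdeg_le P).trans hn)
      let σ : (R ⊗[k] B) ⧸ P'.asIdeal →+* (R ⊗[k] B) ⧸ P.asIdeal := Ideal.Quotient.factor hlt.le
      have hσf : σ.comp (baseMap P') = baseMap P := rfl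
      by_cases hker : RingHom.ker (baseMap P) ≤ RingHom.ker (baseMap P')
      · have hker' : RingHom.ker (baseMap P) = RingHom.ker (baseMap P') :=
          le_antisymm hker fun b hb ↦ by
            rw [RingHom.mem_ker] at hb ⊢
            rw [← hσf, RingHom.comp_apply, hb, map_zero]
        have hinj : ¬ Function.Injective σ := by
          intro hinj
          refine hlt.not_ge fun x hx ↦ ?_
          rw [← Ideal.Quotient.eq_zero_iff_mem] at hx ⊢
          exact hinj (by rw [map_zero]; exact hx)
        have h1 := eTrdeg_range_add_one_le (baseMap P') σ
          (Ideal.Quotient.factor_surjective hlt.le) hinj hker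
        rw [hσf] at h1
        rw [extHeight_congr n _ _ hker']
        calc ((m + 1 : ℕ) : ℕ∞) + residueTrdeg P = m + (residueTrdeg P + 1) := by
              push_cast; ring
          _ ≤ m + residueTrdeg P' := by gcongr; exact h1
          _ ≤ _ := hP'
      · obtain ⟨b, hb, hb'⟩ := SetLike.not_le_iff_exists.1 hker
        obtain ⟨r, hr⟩ := ENat.ne_top_iff_exists.1 (hfin P)
        obtain ⟨r', hr'⟩ := ENat.ne_top_iff_exists.1 (hfin P')
        have hrn : r ≤ n := by
          have := (residueTrdeg_le P).trans hn
          rw [← hr] at this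
          exact_mod_cast this
        obtain ⟨z, hz⟩ := exists_algebraicIndependent_of_le_eTrdeg (Ideal.Quotient.mk P.asIdeal)
          Ideal.Quotient.mk_surjective (baseMap P) (fun _ ↦ rfl) hr.le
        have h1 := extHeight_add_le (baseMap P') σ hrn
          (fun i ↦ Ideal.Quotient.mk P'.asIdeal (z i ⊗ₜ 1)) hz b hb hb'
        rw [hσf] at h1
        change _ ≤ _ + residueTrdeg P' at h1
        rw [← hr'] at h1 hP'
        rw [← hr]
        cases hH : extHeight n (baseMap P) with
        | top => simp
        | coe H =>
          rw [hH] at h1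
          cases hH' : extHeight n (baseMap P') with
          | top =>
            rw [hH', top_add, top_add, top_le_iff] at h1
            exact absurd h1 (by exact_mod_cast ENat.natCast_ne_top (H + r'))
          | coe H' =>
            rw [hH'] at h1 hP'
            norm_cast at h1 hP' ⊢
            omega
  cases hh : Order.height P with
  | top =>
    rw [top_add, top_le_iff]
    refine ENat.eq_top_iff_forall_ge.2 fun m ↦ ?_
    exact le_self_add.trans (key m P (by rw [hh]; exact le_top))
  | coe m => exact key m P hh.ge

lemma exists_le_comap_eq_of_flat {X Y : Type*} [CommRing X] [CommRing Y] {φ : X →+* Y}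
    (hφ : φ.Flat) (Q : PrimeSpectrum Y) (p : PrimeSpectrum X) (hp : p ≤ PrimeSpectrum.comap φ Q) :
    ∃ Q' ≤ Q, PrimeSpectrum.comap φ Q' = p := by
  obtain ⟨Q', hQ', h⟩ := hφ.generalizingMap_comap ((PrimeSpectrum.le_iff_specializes _ _).1 hp)
  exact ⟨Q', (PrimeSpectrum.le_iff_specializes _ _).2 hQ', h⟩

lemma flat_of_injective_of_field {X F : Type*} [CommRing X] [IsDomain X] [Field F] {φ : X →+* F}
    (hφ : Function.Injective φ) : φ.Flat := by
  have h : (IsFractionRing.lift (K := FractionRing X) hφ).comp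
      (algebraMap X (FractionRing X)) = φ :=
    RingHom.ext fun g ↦ IsFractionRing.lift_algebraMap hφ g
  rw [← h]
  refine RingHom.Flat.comp ?_ (RingHom.Flat.of_isField (Field.toIsField _) _)
  rw [RingHom.flat_algebraMap_iff]
  exact IsLocalization.flat _ (nonZeroDivisors X)

/-- A prime of `R ⊗[k] B` over the zero ideal of the domain `R` comes from `Frac R ⊗[k] B`, with
at least the same height. -/
lemma exists_comap_eq_height_le [IsDomain R] (P : PrimeSpectrum (R ⊗[k] B))
    (hP : P.asIdeal.comap (Algebra.TensorProduct.includeLeft : R →ₐ[k] R ⊗[k] B).toRingHom = ⊥) :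
    ∃ Q : PrimeSpectrum (FractionRing R ⊗[k] B),
      PrimeSpectrum.comap (Algebra.TensorProduct.map
        (IsScalarTower.toAlgHom k R (FractionRing R)) (AlgHom.id k B)).toRingHom Q = P ∧
      Order.height Q ≤ Order.height P := by
  let j : R ⊗[k] B →ₐ[k] FractionRing R ⊗[k] B := Algebra.TensorProduct.map
    (IsScalarTower.toAlgHom k R (FractionRing R)) (AlgHom.id k B)
  let _ : Algebra (R ⊗[k] B) (FractionRing R ⊗[k] B) := j.toRingHom.toAlgebra
  have hj : algebraMap (R ⊗[k] B) (FractionRing R ⊗[k] B) = j.toRingHom := rfl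
  have : IsScalarTower R (R ⊗[k] B) (FractionRing R ⊗[k] B) := by
    refine IsScalarTower.of_algebraMap_eq fun r ↦ ?_
    rw [hj]
    simp [j, Algebra.TensorProduct.algebraMap_apply]
  have hloc : IsLocalization (Algebra.algebraMapSubmonoid (R ⊗[k] B) (nonZeroDivisors R))
      (FractionRing R ⊗[k] B) := by
    refine IsLocalization.tensorProduct_tensorProduct k B _ _ ?_
    rw [hj]
    ext b
    simp [j]
  have hdisj : Disjoint (Algebra.algebraMapSubmonoid (R ⊗[k] B) (nonZeroDivisors R) :
      Set (R ⊗[k] B)) P.asIdeal := by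
    rw [Set.disjoint_left]
    rintro _ ⟨r, hr, rfl⟩ hrP
    have : r ∈ P.asIdeal.comap
      (Algebra.TensorProduct.includeLeft : R →ₐ[k] R ⊗[k] B).toRingHom := hrP
    rw [hP, Ideal.mem_bot] at this
    exact nonZeroDivisors.ne_zero hr this
  obtain ⟨Q, hQ⟩ : P ∈ Set.range (PrimeSpectrum.comap
      (algebraMap (R ⊗[k] B) (FractionRing R ⊗[k] B))) := by
    rw [PrimeSpectrum.localization_comap_range (FractionRing R ⊗[k] B)
      (Algebra.algebraMapSubmonoid (R ⊗[k] B) (nonZeroDivisors R))]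
    exact hdisj
  refine ⟨Q, hQ, ?_⟩
  rw [← hQ]
  have hmono : StrictMono (PrimeSpectrum.comap (algebraMap (R ⊗[k] B) (FractionRing R ⊗[k] B))) :=
    Monotone.strictMono_of_injective (fun _ _ h ↦ Ideal.comap_mono h)
      (PrimeSpectrum.localization_comap_injective (FractionRing R ⊗[k] B)
        (Algebra.algebraMapSubmonoid (R ⊗[k] B) (nonZeroDivisors R)))
  exact Order.height_le_height_apply_of_strictMono _ hmono Q

lemma le_height_add_residueTrdeg_of_comap_eq_bot [IsDomain R] {n : ℕ}
    (hn : (n : ℕ∞) ≤ eTrdeg k R) (P : PrimeSpectrum (R ⊗[k] B))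
    (hP : P.asIdeal.comap (Algebra.TensorProduct.includeLeft : R →ₐ[k] R ⊗[k] B).toRingHom = ⊥) :
    n + extHeight n (baseMap P) ≤ Order.height P + residueTrdeg P := by
  obtain ⟨x, hx⟩ := natCast_le_eTrdeg_iff.1 hn
  let y : Fin n → (R ⊗[k] B) ⧸ P.asIdeal := fun i ↦ Ideal.Quotient.mk _ (x i ⊗ₜ 1)
  let θ : MvPolynomial (Fin n) B →+* R ⊗[k] B := MvPolynomial.eval₂Hom
    (Algebra.TensorProduct.includeRight : B →ₐ[k] R ⊗[k] B).toRingHom (fun i ↦ x i ⊗ₜ 1)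
  have h1 := height_kerPoint_map_add_card_le (baseMap P) y Finset.univ
  have hpt : kerPoint (padEval (baseMap P) y Finset.univ) = PrimeSpectrum.comap θ P := by
    refine PrimeSpectrum.ext ?_
    have : padEval (baseMap P) y Finset.univ =
        (MvPolynomial.C (σ := Fin n)).comp ((Ideal.Quotient.mk P.asIdeal).comp θ) := by
      refine MvPolynomial.ringHom_ext (fun b ↦ ?_) fun j ↦ ?_
      · simp [padEval, θ, baseMap]
      · simp [padEval, θ, y]
    ext g
    change _ = _ ↔ θ g ∈ P.asIdeal
    rw [this, RingHom.comp_apply, map_eq_zero_iff _ (MvPolynomial.C_injective _ _),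
      RingHom.comp_apply, Ideal.Quotient.eq_zero_iff_mem]
  obtain ⟨Q, hQ, hQP⟩ := exists_comap_eq_height_le P hP
  set j : R ⊗[k] B →ₐ[k] FractionRing R ⊗[k] B := Algebra.TensorProduct.map
    (IsScalarTower.toAlgHom k R (FractionRing R)) (AlgHom.id k B) with hj
  have hx' : AlgebraicIndependent k (algebraMap R (FractionRing R) ∘ x) :=
    hx.map' (f := IsScalarTower.toAlgHom k R (FractionRing R)) (IsFractionRing.injective _ _)
  have hflat : (j.toRingHom.comp θ).Flat := by
    have h : j.toRingHom.comp θ =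
        (Algebra.TensorProduct.map (MvPolynomial.aeval (algebraMap R (FractionRing R) ∘ x) :
          MvPolynomial (Fin n) k →ₐ[k] FractionRing R) (AlgHom.id k B)).toRingHom.comp
        ((Algebra.TensorProduct.comm k B (MvPolynomial (Fin n) k)).toRingEquiv.toRingHom.comp
          (MvPolynomial.algebraTensorAlgEquiv k B (σ := Fin n)).symm.toRingEquiv.toRingHom) := by
      refine MvPolynomial.ringHom_ext (fun b ↦ ?_) fun i ↦ ?_
      · have : (MvPolynomial.algebraTensorAlgEquiv k B (σ := Fin n)).symm (MvPolynomial.C b) =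
            b ⊗ₜ 1 := AlgEquiv.commutes _ b
        simp [j, θ, this]
      · simp [j, θ]
    rw [h]
    refine RingHom.Flat.comp (.of_bijective ?_) ?_
    · exact (Algebra.TensorProduct.comm k B (MvPolynomial (Fin n) k)).bijective.comp
        (MvPolynomial.algebraTensorAlgEquiv k B (σ := Fin n)).symm.bijective
    · exact RingHom.Flat.tensorProductMap (flat_of_injective_of_field hx')
        (RingHom.Flat.id B)
  have h2 := height_le_of_goingDown (PrimeSpectrum.comap (j.toRingHom.comp θ))
    (exists_le_comap_eq_of_flat hflat) Q
  rw [PrimeSpectrum.comap_comp_apply, hQ, ← hpt] at h2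
  rw [Finset.card_univ, Fintype.card_fin] at h1
  rw [add_comm]
  exact h1.trans (add_le_add_left (h2.trans hQP) _)
lemma eTrdeg_range_le_of_injective {B C C' : Type u} [CommRing B] [CommRing C] [Nontrivial C]
    [CommRing C'] (f : B →+* C) {e : C →+* C'} (he : Function.Injective e) :
    eTrdeg f.range C ≤ eTrdeg (e.comp f).range C' := by
  have : Nontrivial C' := he.nontrivial
  refine ENat.forall_natCast_le_iff_le.1 fun m hm ↦ ?_
  obtain ⟨y, hy⟩ := natCast_le_eTrdeg_iff.1 hm
  refine natCast_le_eTrdeg_iff.2 ⟨e ∘ y, ?_⟩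
  rw [algebraicIndependent_range_iff] at hy ⊢
  intro g hg
  rw [← MvPolynomial.eval₂_comp_left] at hg
  rw [← MvPolynomial.map_map, hy g (he (hg.trans (map_zero e).symm)), map_zero]

lemma ker_baseMap (P : PrimeSpectrum (R ⊗[k] B)) : RingHom.ker (baseMap P) =
    P.asIdeal.comap (Algebra.TensorProduct.includeRight : B →ₐ[k] R ⊗[k] B).toRingHom := by
  rw [baseMap, ← RingHom.comap_ker, Ideal.mk_ker]

lemma extHeight_eq_zero {B C : Type*} [CommRing B] [CommRing C] [IsDomain C] (n : ℕ)
    {f : B →+* C} (hf : RingHom.ker f = ⊥) : extHeight n f = 0 := by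
  rw [extHeight, Order.height_eq_zero]
  intro Q _
  have : (kerPoint (MvPolynomial.map (σ := Fin n) f)).asIdeal = ⊥ := by
    change RingHom.ker (MvPolynomial.map f) = ⊥
    rw [MvPolynomial.ker_map, hf, Ideal.map_bot]
  rw [← PrimeSpectrum.asIdeal_le_asIdeal, this]
  exact bot_le

section Quotient

variable {R' B' : Type} [CommRing R'] [Algebra k R'] [CommRing B'] [Algebra k B']
  {α : R →ₐ[k] R'} {β : B →ₐ[k] B'}

lemma residueTrdeg_comap_map (hα : Function.Surjective α) (hβ : Function.Surjective β)
    (P : PrimeSpectrum (R' ⊗[k] B')) :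
    residueTrdeg (PrimeSpectrum.comap (Algebra.TensorProduct.map α β).toRingHom P) =
      residueTrdeg P := by
  let π : R ⊗[k] B →+* R' ⊗[k] B' := (Algebra.TensorProduct.map α β).toRingHom
  have hπ : Function.Surjective π := Algebra.TensorProduct.map_surjective _ _ hα hβ
  let e : (R ⊗[k] B) ⧸ P.asIdeal.comap π →+* (R' ⊗[k] B') ⧸ P.asIdeal :=
    Ideal.quotientMap P.asIdeal π le_rfl
  have he : Function.Bijective e :=
    ⟨Ideal.quotientMap_injective, Ideal.quotientMap_surjective hπ⟩
  let e' := RingEquiv.ofBijective e he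
  let f := baseMap (PrimeSpectrum.comap π P)
  have hf : e.comp f = (baseMap P).comp (β : B →+* B') := by
    ext b
    change Ideal.Quotient.mk P.asIdeal (Algebra.TensorProduct.map α β (1 ⊗ₜ b)) =
      Ideal.Quotient.mk P.asIdeal (1 ⊗ₜ β b)
    rw [Algebra.TensorProduct.map_tmul, map_one]
  have hrange : (e.comp f).range = (baseMap P).range := by
    rw [hf]
    ext x
    constructor
    · rintro ⟨b, rfl⟩
      exact ⟨β b, rfl⟩
    · rintro ⟨b, rfl⟩
      obtain ⟨b, rfl⟩ := hβ b
      exact ⟨b, rfl⟩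
  have h : ∀ S S' : Subring ((R' ⊗[k] B') ⧸ P.asIdeal), S = S' →
      eTrdeg S ((R' ⊗[k] B') ⧸ P.asIdeal) = eTrdeg S' ((R' ⊗[k] B') ⧸ P.asIdeal) := by
    rintro S _ rfl
    rfl
  refine Eq.trans (le_antisymm (eTrdeg_range_le_of_injective f he.1) ?_) (h _ _ hrange)
  have h1 := eTrdeg_range_le_of_injective (e.comp f) (e := e'.symm.toRingHom) e'.symm.injective
  have h2 : e'.symm.toRingHom.comp (e.comp f) = f := by
    refine RingHom.ext fun b ↦ ?_
    exact e'.symm_apply_apply (f b)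
  rw [h2] at h1
  exact h1

lemma exists_comap_map_eq (hα : Function.Surjective α) (hβ : Function.Surjective β)
    (P : PrimeSpectrum (R ⊗[k] B))
    (hα' : RingHom.ker α ≤
      P.asIdeal.comap (Algebra.TensorProduct.includeLeft : R →ₐ[k] R ⊗[k] B).toRingHom)
    (hβ' : RingHom.ker β ≤
      P.asIdeal.comap (Algebra.TensorProduct.includeRight : B →ₐ[k] R ⊗[k] B).toRingHom) :
    ∃ Q : PrimeSpectrum (R' ⊗[k] B'),
      PrimeSpectrum.comap (Algebra.TensorProduct.map α β).toRingHom Q = P := by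
  have h := range_comap_of_surjective _ (Algebra.TensorProduct.map α β).toRingHom
    (Algebra.TensorProduct.map_surjective _ _ hα hβ)
  change P ∈ Set.range _
  rw [h]
  change RingHom.ker (Algebra.TensorProduct.map α β) ≤ P.asIdeal
  refine (Algebra.TensorProduct.map_ker α β hα hβ).le.trans ?_
  exact sup_le (Ideal.map_le_iff_le_comap.2 hα') (Ideal.map_le_iff_le_comap.2 hβ')

lemma strictMono_comap_map (hα : Function.Surjective α) (hβ : Function.Surjective β) :
    StrictMono (PrimeSpectrum.comap (Algebra.TensorProduct.map α β).toRingHom) :=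
  Monotone.strictMono_of_injective (fun _ _ h ↦ Ideal.comap_mono h)
    (PrimeSpectrum.comap_injective_of_surjective _
      (Algebra.TensorProduct.map_surjective _ _ hα hβ))

/-- Contracting first to `R` after passing to quotients. -/
lemma comap_includeLeft_comap_map (P : PrimeSpectrum (R' ⊗[k] B')) :
    (PrimeSpectrum.comap (Algebra.TensorProduct.map α β).toRingHom P).asIdeal.comap
      (Algebra.TensorProduct.includeLeft : R →ₐ[k] R ⊗[k] B).toRingHom =
    (P.asIdeal.comap (Algebra.TensorProduct.includeLeft : R' →ₐ[k] R' ⊗[k] B').toRingHom).comap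
      α := by
  ext r
  simp [Ideal.mem_comap]

lemma comap_includeRight_comap_map (P : PrimeSpectrum (R' ⊗[k] B')) :
    (PrimeSpectrum.comap (Algebra.TensorProduct.map α β).toRingHom P).asIdeal.comap
      (Algebra.TensorProduct.includeRight : B →ₐ[k] R ⊗[k] B).toRingHom =
    (P.asIdeal.comap (Algebra.TensorProduct.includeRight : B' →ₐ[k] R' ⊗[k] B').toRingHom).comap
      β := by
  ext r
  simp [Ideal.mem_comap]

lemma eq_bot_of_comap_eq_ker {X Y : Type*} [CommRing X] [CommRing Y] {f : X →+* Y}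
    (hf : Function.Surjective f) {I : Ideal Y} (h : I.comap f = RingHom.ker f) : I = ⊥ :=
  Ideal.comap_injective_of_surjective f hf h

end Quotient

lemma le_comap_mk {X : Type*} [CommRing X] (I : Ideal X) (J : Ideal (X ⧸ I)) :
    I ≤ J.comap (Ideal.Quotient.mk I) := fun x hx ↦ by
  rw [Ideal.mem_comap, Ideal.Quotient.eq_zero_iff_mem.2 hx]
  exact zero_mem _

/-- The contraction of a prime of `R ⊗[k] B` to `R`. -/
def leftPoint (P : PrimeSpectrum (R ⊗[k] B)) : PrimeSpectrum R :=
  PrimeSpectrum.comap (Algebra.TensorProduct.includeLeft : R →ₐ[k] R ⊗[k] B).toRingHom P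

lemma le_leftPoint_comap_map_mk {p : Ideal R} {q : Ideal B}
    (Q : PrimeSpectrum ((R ⧸ p) ⊗[k] (B ⧸ q))) :
    p ≤ (leftPoint (PrimeSpectrum.comap (Algebra.TensorProduct.map (Ideal.Quotient.mkₐ k p)
        (Ideal.Quotient.mkₐ k q)).toRingHom Q)).asIdeal :=
  (le_comap_mk p _).trans (comap_includeLeft_comap_map (α := Ideal.Quotient.mkₐ k p)
    (β := Ideal.Quotient.mkₐ k q) Q).ge

lemma le_ker_baseMap_comap_map_mk {p : Ideal R} {q : Ideal B}
    (Q : PrimeSpectrum ((R ⧸ p) ⊗[k] (B ⧸ q))) :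
    q ≤ RingHom.ker (baseMap (PrimeSpectrum.comap (Algebra.TensorProduct.map
      (Ideal.Quotient.mkₐ k p) (Ideal.Quotient.mkₐ k q)).toRingHom Q)) := by
  rw [ker_baseMap]
  exact (le_comap_mk q _).trans (comap_includeRight_comap_map (α := Ideal.Quotient.mkₐ k p)
    (β := Ideal.Quotient.mkₐ k q) Q).ge

/-- A prime of `R ⊗[k] B` comes from the tensor product of the quotients by its contractions. -/
lemma exists_comap_map_mk_eq (P : PrimeSpectrum (R ⊗[k] B)) {p : Ideal R} {q : Ideal B}
    (hp : p = (leftPoint P).asIdeal) (hq : q = RingHom.ker (baseMap P)) :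
    ∃ Q : PrimeSpectrum ((R ⧸ p) ⊗[k] (B ⧸ q)),
      PrimeSpectrum.comap (Algebra.TensorProduct.map (Ideal.Quotient.mkₐ k p)
        (Ideal.Quotient.mkₐ k q)).toRingHom Q = P ∧
      Q.asIdeal.comap (Algebra.TensorProduct.includeLeft :
        R ⧸ p →ₐ[k] (R ⧸ p) ⊗[k] (B ⧸ q)).toRingHom = ⊥ ∧
      RingHom.ker (baseMap Q) = ⊥ := by
  obtain ⟨Q, hQ⟩ := exists_comap_map_eq (Ideal.Quotient.mkₐ_surjective k p)
    (Ideal.Quotient.mkₐ_surjective k q) P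
    ((Ideal.Quotient.mkₐ_ker k p).le.trans hp.le)
    ((Ideal.Quotient.mkₐ_ker k q).le.trans (hq.trans (ker_baseMap P)).le)
  refine ⟨Q, hQ, ?_, ?_⟩
  · refine eq_bot_of_comap_eq_ker (f := (Ideal.Quotient.mkₐ k p).toRingHom)
      (Ideal.Quotient.mkₐ_surjective k p) ?_
    refine (comap_includeLeft_comap_map (α := Ideal.Quotient.mkₐ k p)
      (β := Ideal.Quotient.mkₐ k q) Q).symm.trans ?_
    rw [hQ]
    exact hp.symm.trans (Ideal.Quotient.mkₐ_ker k p).symm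
  · rw [ker_baseMap]
    refine eq_bot_of_comap_eq_ker (f := (Ideal.Quotient.mkₐ k q).toRingHom)
      (Ideal.Quotient.mkₐ_surjective k q) ?_
    refine (comap_includeRight_comap_map (α := Ideal.Quotient.mkₐ k p)
      (β := Ideal.Quotient.mkₐ k q) Q).symm.trans ?_
    rw [hQ, ← ker_baseMap]
    exact hq.symm.trans (Ideal.Quotient.mkₐ_ker k q).symm

/-- The going-down step: below a prime over `p` there are primes over `⊥`, with the same
contraction to `B`, lower by at least the height of `p`. -/
lemma exists_leftPoint_eq_bot [IsDomain R] (P : PrimeSpectrum (R ⊗[k] B)) {a : ℕ}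
    (ha : (a : ℕ∞) ≤ Order.height (leftPoint P)) :
    ∃ P₀ : PrimeSpectrum (R ⊗[k] B), (leftPoint P₀).asIdeal = ⊥ ∧
      RingHom.ker (baseMap P₀) = RingHom.ker (baseMap P) ∧
      a + Order.height P₀ ≤ Order.height P := by
  let q := RingHom.ker (baseMap P)
  have hid : Function.Surjective (AlgHom.id k R) := Function.surjective_id
  have hmk := Ideal.Quotient.mkₐ_surjective k q
  obtain ⟨Q, hQ⟩ := exists_comap_map_eq hid hmk P
    (fun x hx ↦ by
      rw [RingHom.mem_ker] at hx
      change x = 0 at hx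
      rw [hx]
      exact zero_mem _)
    ((Ideal.Quotient.mkₐ_ker k q).le.trans (ker_baseMap P).le)
  let g := PrimeSpectrum.comap (Algebra.TensorProduct.map (AlgHom.id k R)
    (Ideal.Quotient.mkₐ k q)).toRingHom
  have hg : StrictMono g := strictMono_comap_map hid hmk
  have hleft : ∀ Q : PrimeSpectrum (R ⊗[k] (B ⧸ q)), leftPoint (g Q) = leftPoint Q := fun Q ↦
    PrimeSpectrum.ext (comap_includeLeft_comap_map Q)
  have hright : ∀ Q : PrimeSpectrum (R ⊗[k] (B ⧸ q)), RingHom.ker (baseMap (g Q)) =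
      (RingHom.ker (baseMap Q)).comap (Ideal.Quotient.mkₐ k q) := fun Q ↦ by
    rw [ker_baseMap, ker_baseMap]
    exact comap_includeRight_comap_map Q
  have hgd : ∀ Q : PrimeSpectrum (R ⊗[k] (B ⧸ q)), ∀ p ≤ leftPoint Q,
      ∃ Q' ≤ Q, leftPoint Q' = p := by
    refine exists_le_comap_eq_of_flat ?_
    exact (RingHom.flat_algebraMap_iff (R := R) (S := R ⊗[k] (B ⧸ q))).2 inferInstance
  rw [← hQ] at ha
  change _ ≤ Order.height (leftPoint (g Q)) at ha
  rw [hleft] at ha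
  obtain ⟨Q₁, hQ₁, h1⟩ := exists_le_add_height_le_of_strictMono hg a Q
    (ha.trans (height_le_of_goingDown _ hgd Q))
  obtain ⟨Q₀, hQ₀, h0⟩ := hgd Q₁ ⊥ bot_le
  refine ⟨g Q₀, ?_, ?_, ?_⟩
  · rw [hleft, h0]
    rfl
  · have hle : RingHom.ker (baseMap Q₀) ≤ RingHom.ker (baseMap Q) := by
      rw [ker_baseMap, ker_baseMap]
      exact Ideal.comap_mono (hQ₀.trans hQ₁)
    refine le_antisymm ?_ ?_
    · change _ ≤ _ at hle
      rw [hright]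
      refine (Ideal.comap_mono hle).trans ?_
      rw [← hright]
      rw [show g Q = P from hQ]
    · rw [hright]
      exact le_comap_mk q _
  · rw [← hQ]
    refine le_trans ?_ h1
    gcongr
    exact (hg.monotone hQ₀)

lemma le_height_add_residueTrdeg [IsDomain R] {n : ℕ} (hn : eTrdeg k R = n)
    (P : PrimeSpectrum (R ⊗[k] B))
    (h : (n : ℕ∞) ≤ Order.height (leftPoint P) + eTrdeg k (R ⧸ (leftPoint P).asIdeal)) :
    n + extHeight n (baseMap P) ≤ Order.height P + residueTrdeg P := by
  let p := (leftPoint P).asIdeal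
  let q := RingHom.ker (baseMap P)
  obtain ⟨a, s, ha, hs, hnas⟩ : ∃ a s : ℕ, (a : ℕ∞) ≤ Order.height (leftPoint P) ∧
      (s : ℕ∞) ≤ eTrdeg k (R ⧸ p) ∧ n ≤ a + s := by
    change (n : ℕ∞) ≤ _ + eTrdeg k (R ⧸ p) at h
    cases hx : Order.height (leftPoint P) with
    | top => exact ⟨n, 0, le_top, zero_le, le_rfl⟩
    | coe a =>
      cases hy : eTrdeg k (R ⧸ p) with
      | top => exact ⟨0, n, zero_le, le_top, by omega⟩
      | coe s =>
        rw [hx, hy] at h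
        exact ⟨a, s, le_rfl, le_rfl, by exact_mod_cast h⟩
  obtain ⟨Q, hQP, hQl, hQr⟩ := exists_comap_map_mk_eq P (p := p) (q := q) rfl rfl
  let g := PrimeSpectrum.comap (Algebra.TensorProduct.map (Ideal.Quotient.mkₐ k p)
    (Ideal.Quotient.mkₐ k q)).toRingHom
  have hg : StrictMono g := strictMono_comap_map (Ideal.Quotient.mkₐ_surjective k p)
    (Ideal.Quotient.mkₐ_surjective k q)
  have hFQ := le_height_add_residueTrdeg_of_comap_eq_bot hs Q hQl
  have hrQ : residueTrdeg Q = residueTrdeg P := by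
    rw [← hQP, residueTrdeg_comap_map (Ideal.Quotient.mkₐ_surjective k p)
      (Ideal.Quotient.mkₐ_surjective k q)]
  rw [hrQ] at hFQ
  have hrn : residueTrdeg P ≤ n := (residueTrdeg_le P).trans hn.le
  obtain ⟨r, hr⟩ := ENat.ne_top_iff_exists.1 (ne_top_of_le_ne_top (ENat.natCast_ne_top n) hrn)
  obtain ⟨m, hm, hsm⟩ : ∃ m : ℕ, (m : ℕ∞) ≤ Order.height Q ∧ s ≤ m + r := by
    have hFQ' := le_self_add.trans hFQ
    rw [← hr] at hFQ'
    cases hx : Order.height Q with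
    | top => exact ⟨s, le_top, by omega⟩
    | coe m =>
      rw [hx] at hFQ'
      exact ⟨m, le_rfl, by exact_mod_cast hFQ'⟩
  obtain ⟨Q₁, hQ₁, h1⟩ := exists_le_add_height_le_of_strictMono hg m Q hm
  have hl1 : leftPoint (g Q₁) = leftPoint P := by
    refine le_antisymm ?_ ?_
    · rw [← hQP]
      exact Ideal.comap_mono (hg.monotone hQ₁)
    · exact le_leftPoint_comap_map_mk Q₁
  have hr1 : RingHom.ker (baseMap (g Q₁)) = q := by
    refine le_antisymm ?_ ?_
    · change _ ≤ RingHom.ker (baseMap P)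
      rw [← hQP, ker_baseMap, ker_baseMap]
      exact Ideal.comap_mono (hg.monotone hQ₁)
    · exact le_ker_baseMap_comap_map_mk Q₁
  rw [← hl1] at ha
  obtain ⟨P₀, hP₀l, hP₀r, h0⟩ := exists_leftPoint_eq_bot (g Q₁) ha
  have hF0 := le_height_add_residueTrdeg_of_comap_eq_bot hn.ge P₀ hP₀l
  have hr0 : residueTrdeg P₀ ≤ n := (residueTrdeg_le P₀).trans hn.le
  rw [extHeight_congr n (baseMap P₀) (baseMap P) (hP₀r.trans hr1)] at hF0
  change m + Order.height (g Q₁) ≤ Order.height (g Q) at h1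
  rw [show g Q = P from hQP] at h1
  have hH : extHeight n (baseMap P) ≤ Order.height P₀ := by
    have h2 : n + extHeight n (baseMap P) ≤ n + Order.height P₀ :=
      hF0.trans ((add_le_add_right hr0 _).trans (add_comm _ _).le)
    exact (ENat.add_le_add_iff_left (ENat.natCast_ne_top n)).1 h2
  rw [← hr]
  calc (n : ℕ∞) + extHeight n (baseMap P) ≤ ((m + r + a : ℕ) : ℕ∞) + Order.height P₀ := by
        gcongr
        omega
    _ = m + (a + Order.height P₀) + r := by push_cast; ring
    _ ≤ m + Order.height (g Q₁) + r := by gcongr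
    _ ≤ _ := by gcongr

lemma idealHt_asIdeal {X : Type*} [CommRing X] (P : PrimeSpectrum X) :
    idealHt P.asIdeal = Order.height P :=
  le_antisymm (iInf_le (fun Q : { Q : PrimeSpectrum X // P.asIdeal ≤ Q.asIdeal } ↦
    Order.height Q.1) ⟨P, le_rfl⟩) (le_iInf fun Q ↦ Order.height_mono Q.2)

lemma idealHt_map_mk_ker {X Y : Type*} [CommRing X] [CommRing Y] {π : X →+* Y}
    (hπ : Function.Surjective π) (Q : PrimeSpectrum Y) :
    idealHt ((PrimeSpectrum.comap π Q).asIdeal.map (Ideal.Quotient.mk (RingHom.ker π))) =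
      Order.height Q := by
  let e : X ⧸ RingHom.ker π ≃+* Y := RingHom.quotientKerEquivOfSurjective hπ
  have h : (PrimeSpectrum.comap π Q).asIdeal.map (Ideal.Quotient.mk (RingHom.ker π)) =
      (PrimeSpectrum.comap e.toRingHom Q).asIdeal := by
    have hcomp : e.toRingHom.comp (Ideal.Quotient.mk (RingHom.ker π)) = π := by
      ext x
      rfl
    have : (PrimeSpectrum.comap π Q).asIdeal =
        (PrimeSpectrum.comap e.toRingHom Q).asIdeal.comap (Ideal.Quotient.mk (RingHom.ker π)) := by
      rw [PrimeSpectrum.comap_asIdeal, PrimeSpectrum.comap_asIdeal, Ideal.comap_comap, hcomp]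
    rw [this, Ideal.map_comap_of_surjective _ Ideal.Quotient.mk_surjective]
  rw [h, idealHt_asIdeal]
  exact Order.height_orderIso (PrimeSpectrum.comapEquiv e.symm) Q

lemma eTrdeg_range_algebraMap {C : Type} [CommRing C] [Algebra k C] [Nontrivial C] :
    eTrdeg (algebraMap k C).range C = eTrdeg k C := by
  refine ENat.eq_of_forall_natCast_le_iff fun m ↦ ?_
  rw [natCast_le_eTrdeg_iff, natCast_le_eTrdeg_iff]
  refine exists_congr fun y ↦ ?_
  rw [algebraicIndependent_range_iff, algebraicIndependent_iff]
  refine forall_congr' fun g ↦ imp_congr Iff.rfl ?_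
  exact map_eq_zero_iff _ (MvPolynomial.map_injective _ (algebraMap k C).injective)

lemma height_add_eTrdeg_quotient_le_s10 {n : ℕ} (hn : eTrdeg k R ≤ n) (p : PrimeSpectrum R) :
    Order.height p + eTrdeg k (R ⧸ p.asIdeal) ≤ n := by
  have key : ∀ (m : ℕ) (p : PrimeSpectrum R), (m : ℕ∞) ≤ Order.height p →
      m + eTrdeg k (R ⧸ p.asIdeal) ≤ n := by
    intro m
    induction m with
    | zero =>
      intro p _
      have : Nontrivial R := p.nontrivial
      rw [Nat.cast_zero, zero_add]
      refine le_trans (ENat.forall_natCast_le_iff_le.1 fun j hj ↦ ?_) hn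
      obtain ⟨y, hy⟩ := natCast_le_eTrdeg_iff.1 hj
      choose z hz using fun i ↦ Ideal.Quotient.mk_surjective (y i)
      refine natCast_le_eTrdeg_iff.2 ⟨z, AlgebraicIndependent.of_comp
        (Ideal.Quotient.mkₐ k p.asIdeal) ?_⟩
      rwa [show Ideal.Quotient.mkₐ k p.asIdeal ∘ z = y from funext hz]
    | succ m ih =>
      intro p hm
      obtain ⟨p', hlt, hm'⟩ := exists_lt_of_succ_le_height hm
      let σ : R ⧸ p'.asIdeal →+* R ⧸ p.asIdeal := Ideal.Quotient.factor hlt.le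
      have hinj : ¬ Function.Injective σ := by
        intro hinj
        refine hlt.not_ge fun x hx ↦ ?_
        rw [← Ideal.Quotient.eq_zero_iff_mem] at hx ⊢
        exact hinj (by rw [map_zero]; exact hx)
      have h1 := eTrdeg_range_add_one_le (algebraMap k (R ⧸ p'.asIdeal)) σ
        (Ideal.Quotient.factor_surjective hlt.le) hinj (by
          rw [(RingHom.injective_iff_ker_eq_bot _).1 (σ.comp (algebraMap k _)).injective]
          exact bot_le)
      rw [show σ.comp (algebraMap k (R ⧸ p'.asIdeal)) = algebraMap k (R ⧸ p.asIdeal) from rfl,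
        eTrdeg_range_algebraMap, eTrdeg_range_algebraMap] at h1
      calc ((m + 1 : ℕ) : ℕ∞) + eTrdeg k (R ⧸ p.asIdeal)
          = m + (eTrdeg k (R ⧸ p.asIdeal) + 1) := by push_cast; ring
        _ ≤ m + eTrdeg k (R ⧸ p'.asIdeal) := by gcongr
        _ ≤ n := ih p' hm'
  cases hh : Order.height p with
  | top =>
    have := (key (n + 1) p (by rw [hh]; exact le_top))
    have := le_self_add.trans this
    norm_cast at this
    omega
  | coe m => exact key m p hh.ge

/-- The height formula for a prime of `R ⊗[k] B` whose contraction to `R` satisfies the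
altitude formula. -/
theorem height_eq_of_altitude [IsDomain R] {n : ℕ} (hn : eTrdeg k R = n)
    (P : PrimeSpectrum (R ⊗[k] B)) {p : Ideal R} {q : Ideal B}
    (hp : p = (leftPoint P).asIdeal) (hq : q = RingHom.ker (baseMap P))
    (h : (n : ℕ∞) ≤ Order.height (leftPoint P) + eTrdeg k (R ⧸ p)) :
    Order.height P = Order.height (leftPoint P) + extHeight n (baseMap P) +
      idealHt (P.asIdeal.map (Ideal.Quotient.mk
        (p.map (Algebra.TensorProduct.includeLeft : R →ₐ[k] R ⊗[k] B).toRingHom ⊔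
          q.map (Algebra.TensorProduct.includeRight : B →ₐ[k] R ⊗[k] B).toRingHom))) := by
  obtain ⟨Q, hQP, hQl, hQr⟩ := exists_comap_map_mk_eq P hp hq
  have hα := Ideal.Quotient.mkₐ_surjective k p
  have hβ := Ideal.Quotient.mkₐ_surjective k q
  have hprime : p.IsPrime := hp ▸ (leftPoint P).isPrime
  have hker : p.map (Algebra.TensorProduct.includeLeft : R →ₐ[k] R ⊗[k] B).toRingHom ⊔
      q.map (Algebra.TensorProduct.includeRight : B →ₐ[k] R ⊗[k] B).toRingHom =
      RingHom.ker (Algebra.TensorProduct.map (Ideal.Quotient.mkₐ k p)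
        (Ideal.Quotient.mkₐ k q)).toRingHom := by
    refine Eq.trans ?_ (Algebra.TensorProduct.map_ker _ _ hα hβ).symm
    have h1 : RingHom.ker (Ideal.Quotient.mkₐ k p) = p := Ideal.Quotient.mkₐ_ker k p
    have h2 : RingHom.ker (Ideal.Quotient.mkₐ k q) = q := Ideal.Quotient.mkₐ_ker k q
    rw [h1, h2]
    rfl
  have hPQ : idealHt (P.asIdeal.map (Ideal.Quotient.mk
        (p.map (Algebra.TensorProduct.includeLeft : R →ₐ[k] R ⊗[k] B).toRingHom ⊔
          q.map (Algebra.TensorProduct.includeRight : B →ₐ[k] R ⊗[k] B).toRingHom))) =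
      Order.height Q := by
    rw [hker, ← hQP]
    exact idealHt_map_mk_ker (Algebra.TensorProduct.map_surjective _ _ hα hβ) Q
  have hrQ : residueTrdeg Q = residueTrdeg P := by
    rw [← hQP, residueTrdeg_comap_map hα hβ]
  have hdom : Order.height (leftPoint P) + eTrdeg k (R ⧸ p) ≤ n := by
    rw [hp]
    exact height_add_eTrdeg_quotient_le_s10 hn.le _
  have heq := le_antisymm hdom h
  obtain ⟨s, hs⟩ := ENat.ne_top_iff_exists.1
    (ne_top_of_le_ne_top (ENat.natCast_ne_top n) (le_add_self.trans hdom))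
  have hQ : Order.height Q + residueTrdeg P = s := by
    have h1 := height_add_residueTrdeg_le hs.ge Q
    have h2 := le_height_add_residueTrdeg_of_comap_eq_bot hs.le Q hQl
    rw [extHeight_eq_zero _ hQr, add_zero, hrQ] at h1 h2
    exact le_antisymm h1 h2
  have hP : Order.height P + residueTrdeg P = n + extHeight n (baseMap P) :=
    le_antisymm (height_add_residueTrdeg_le hn.le P)
      (le_height_add_residueTrdeg hn P (by rw [← hp]; exact h))
  have hrn : residueTrdeg P ≠ ⊤ :=
    ne_top_of_le_ne_top (ENat.natCast_ne_top n) ((residueTrdeg_le P).trans hn.le)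
  refine ENat.add_left_injective_of_ne_top hrn ?_
  beta_reduce
  rw [hP, hPQ, ← heq, ← hs, ← hQ]
  ring

end TensorProduct

section Pullback

variable {k T : Type} [Field k] [CommRing T] [Algebra k T] {A : Subalgebra k T}

/-- For `m ∈ A` with `m T ⊆ A`, the contraction `Spec T → Spec A` is strictly monotone away
from `m`, hence does not lower heights. -/
lemma height_le_height_comap_val {m : A} (hm : ∀ t : T, (m : T) * t ∈ A) (Q : PrimeSpectrum T)
    (hQ : (m : T) ∉ Q.asIdeal) :
    Order.height Q ≤ Order.height (PrimeSpectrum.comap A.val.toRingHom Q) := by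
  refine ENat.forall_natCast_le_iff_le.1 fun j ↦ ?_
  induction j generalizing Q with
  | zero => simp
  | succ j ih =>
    intro hj
    obtain ⟨Q', hlt, hj'⟩ := exists_lt_of_succ_le_height hj
    have hQ' : (m : T) ∉ Q'.asIdeal := fun h ↦ hQ (hlt.le h)
    have hlt' : PrimeSpectrum.comap A.val.toRingHom Q' < PrimeSpectrum.comap A.val.toRingHom Q := by
      refine lt_of_le_not_ge (Ideal.comap_mono hlt.le) fun hge ↦ hlt.not_ge fun t ht ↦ ?_
      have h1 : (m : T) * t ∈ Q'.asIdeal :=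
        hge (x := ⟨m * t, hm t⟩) (Q.asIdeal.mul_mem_left _ ht)
      exact (Q'.isPrime.mem_or_mem h1).resolve_left hQ'
    push_cast
    exact (add_le_add_left (ih Q' hQ' hj') 1).trans (Order.height_add_one_le hlt')

lemma exists_comap_val_eq {m : A} (hm : ∀ t : T, (m : T) * t ∈ A) (p : PrimeSpectrum A)
    (hp : m ∉ p.asIdeal) :
    ∃ Q : PrimeSpectrum T, (m : T) ∉ Q.asIdeal ∧ PrimeSpectrum.comap A.val.toRingHom Q = p := by
  let μ : T → A := fun t ↦ ⟨m * t, hm t⟩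
  let I : Ideal T :=
    { carrier := {t | μ t ∈ p.asIdeal}
      zero_mem' := by
        have : μ 0 = 0 := Subtype.ext (mul_zero _)
        change μ 0 ∈ p.asIdeal
        rw [this]
        exact zero_mem _
      add_mem' := fun {x y} hx hy ↦ by
        have : μ (x + y) = μ x + μ y := Subtype.ext (mul_add _ _ _)
        change μ (x + y) ∈ p.asIdeal
        rw [this]
        exact add_mem hx hy
      smul_mem' := fun c x hx ↦ by
        have : m * μ (c * x) = μ c * μ x :=
          Subtype.ext (by change (m : T) * (m * (c * x)) = m * c * (m * x); ring)
        change μ (c * x) ∈ p.asIdeal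
        refine (p.isPrime.mem_or_mem ?_).resolve_left hp
        rw [this]
        exact p.asIdeal.mul_mem_left _ hx }
  have hI : ∀ a : A, (a : T) ∈ I ↔ a ∈ p.asIdeal := by
    intro a
    have : μ a = m * a := rfl
    change μ a ∈ p.asIdeal ↔ _
    rw [this, p.isPrime.mul_mem_iff_mem_or_mem]
    simp [hp]
  have hprime : I.IsPrime := by
    refine ⟨fun h ↦ ?_, fun {x y} hxy ↦ ?_⟩
    · exact hp ((hI m).1 (h ▸ Submodule.mem_top))
    · have h1 : m * μ (x * y) = μ x * μ y :=
        Subtype.ext (by change (m : T) * (m * (x * y)) = m * x * (m * y); ring)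
      refine p.isPrime.mem_or_mem (x := μ x) (y := μ y) ?_
      rw [← h1]
      exact p.asIdeal.mul_mem_left _ hxy
  exact ⟨⟨I, hprime⟩, fun h ↦ hp ((hI m).1 h), PrimeSpectrum.ext (Ideal.ext hI)⟩

lemma eTrdeg_quotient_le_quotient_comap_val {m : A} (hm : ∀ t : T, (m : T) * t ∈ A)
    (Q : PrimeSpectrum T) (hQ : (m : T) ∉ Q.asIdeal) {p : PrimeSpectrum A}
    (hp : PrimeSpectrum.comap A.val.toRingHom Q = p) :
    eTrdeg k (T ⧸ Q.asIdeal) ≤ eTrdeg k (A ⧸ p.asIdeal) := by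
  let ψ : A →ₐ[k] T ⧸ Q.asIdeal := (Ideal.Quotient.mkₐ k Q.asIdeal).comp A.val
  let s : Set (T ⧸ Q.asIdeal) := Set.range ψ
  have hs : ∀ a : A, ψ a ∈ Algebra.adjoin k s := fun a ↦ Algebra.subset_adjoin ⟨a, rfl⟩
  have : Algebra.IsAlgebraic (Algebra.adjoin k s) (T ⧸ Q.asIdeal) := by
    refine ⟨fun c ↦ ?_⟩
    obtain ⟨t, rfl⟩ := Ideal.Quotient.mk_surjective c
    let x : Algebra.adjoin k s := ⟨ψ m, hs m⟩
    let y : Algebra.adjoin k s := ⟨ψ ⟨m * t, hm t⟩, hs _⟩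
    refine ⟨Polynomial.C x * Polynomial.X - Polynomial.C y, fun h ↦ hQ ?_, ?_⟩
    · have h1 := congrArg (fun f ↦ f.coeff 1) h
      simp only [Polynomial.coeff_sub, Polynomial.coeff_C_mul, Polynomial.coeff_X_one, mul_one,
        Polynomial.coeff_C_of_ne_zero one_ne_zero, sub_zero, Polynomial.coeff_zero] at h1
      exact Ideal.Quotient.eq_zero_iff_mem.1 (congrArg Subtype.val h1)
    · rw [map_sub, map_mul, Polynomial.aeval_C, Polynomial.aeval_C, Polynomial.aeval_X, sub_eq_zero]
      rfl
  obtain ⟨t, hts, ht⟩ := exists_isTranscendenceBasis_subset (R := k) s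
  have hcard : Cardinal.mk t = trdegC k (T ⧸ Q.asIdeal) := ht.cardinalMk_eq_trdeg
  refine ENat.forall_natCast_le_iff_le.1 fun j hj ↦ ?_
  rw [eTrdeg, Cardinal.natCast_le_toENat, ← hcard] at hj
  have hle : Cardinal.mk (Fin j) ≤ Cardinal.mk t := by simpa using hj
  obtain ⟨e⟩ := hle
  choose z hz using fun i ↦ hts (e i).2
  have hind : AlgebraicIndependent k (fun i ↦ ψ (z i)) := by
    simp only [hz]
    exact ht.1.comp e e.injective
  have : FaithfulSMul k (A ⧸ p.asIdeal) :=
    (faithfulSMul_iff_algebraMap_injective k _).2 (algebraMap k (A ⧸ p.asIdeal)).injective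
  exact natCast_le_eTrdeg_iff.2 ⟨fun i ↦ Ideal.Quotient.mk _ (z i),
    AlgebraicIndependent.of_comp (Ideal.quotientMapₐ Q.asIdeal A.val hp.ge) hind⟩

lemma IsAFDomain.eTrdeg_subalgebra_le [IsDomain T] (hT : IsAFDomain k T) {m : A}
    (hm : ∀ t : T, (m : T) * t ∈ A) (p : PrimeSpectrum A) (hp : m ∉ p.asIdeal) :
    eTrdeg k A ≤ Order.height p + eTrdeg k (A ⧸ p.asIdeal) := by
  obtain ⟨Q, hQ, hQp⟩ := exists_comap_val_eq hm p hp
  have hAT : eTrdeg k A ≤ eTrdeg k T := by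
    refine ENat.forall_natCast_le_iff_le.1 fun j hj ↦ ?_
    obtain ⟨y, hy⟩ := natCast_le_eTrdeg_iff.1 hj
    exact natCast_le_eTrdeg_iff.2 ⟨_, hy.map' (f := A.val) Subtype.val_injective⟩
  refine hAT.trans ?_
  rw [← hT Q.asIdeal Q.isPrime, idealHt_asIdeal]
  exact add_le_add (hQp ▸ height_le_height_comap_val hm Q hQ)
    (eTrdeg_quotient_le_quotient_comap_val hm Q hQ hQp)

end Pullback

/-- pullback `A = φ⁻¹(D)` with `T`, `D` AF-domains and `T_M` catenarian;
for a prime `P` of `A ⊗[k] B` with `p = P ∩ A`, `q = P ∩ B` and `M ⊄ p`,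
`ht P = ht p + ht (q[t.d.(A)]) + ht (P/(p⊗B + A⊗q))`. -/
theorem stmt_10 (k T : Type) [Field k] [CommRing T] [IsDomain T] [Algebra k T]
    (hTfin : eTrdeg k T ≠ ⊤)
    (M : Ideal T) [hM : M.IsMaximal]
    (D : Subalgebra k (T ⧸ M))
    (A : Subalgebra k T) (hA : A = D.comap (Ideal.Quotient.mkₐ k M))
    (hTAF : IsAFDomain k T) (hDAF : IsAFDomain k ↥D)
    (hcat : IsCatenarian (Localization.AtPrime M))
    (B : Type) [CommRing B] [Algebra k B] (hBfin : eTrdeg k B ≠ ⊤)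
    (ta : ℕ) (hta : eTrdeg k ↥A = ta)
    (P : Ideal (↥A ⊗[k] B)) (hP : P.IsPrime)
    (p : Ideal ↥A)
    (hp : p = P.comap (Algebra.TensorProduct.includeLeft : ↥A →ₐ[k] ↥A ⊗[k] B).toRingHom)
    (q : Ideal B)
    (hq : q = P.comap (Algebra.TensorProduct.includeRight : B →ₐ[k] ↥A ⊗[k] B).toRingHom)
    (hMp : ¬ M.comap (Subalgebra.val A).toRingHom ≤ p) :
    idealHt P = idealHt p + idealHt (polyExt ta q) +
      idealHt (P.map (Ideal.Quotient.mk
        (p.map (Algebra.TensorProduct.includeLeft : ↥A →ₐ[k] ↥A ⊗[k] B).toRingHom ⊔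
         q.map (Algebra.TensorProduct.includeRight : B →ₐ[k] ↥A ⊗[k] B).toRingHom))) := by
  obtain ⟨m, hmM, hmp⟩ := SetLike.not_le_iff_exists.1 hMp
  have hm : ∀ t : T, (m : T) * t ∈ A := by
    intro t
    have h0 : Ideal.Quotient.mkₐ k M ((m : T) * t) = 0 :=
      Ideal.Quotient.eq_zero_iff_mem.2 (M.mul_mem_right t hmM)
    refine hA.ge ?_
    rw [Subalgebra.mem_comap, h0]
    exact zero_mem _
  let P' : PrimeSpectrum (A ⊗[k] B) := ⟨P, hP⟩
  have hp' : p = (leftPoint P').asIdeal := hp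
  have hq' : q = RingHom.ker (baseMap P') := hq.trans (ker_baseMap P').symm
  have halt := hTAF.eTrdeg_subalgebra_le hm (leftPoint P') (hp' ▸ hmp)
  rw [← hp', hta] at halt
  have h := height_eq_of_altitude hta P' hp' hq' halt
  have hext : idealHt (polyExt ta q) = extHeight ta (baseMap P') := by
    rw [extHeight, ← idealHt_asIdeal, polyExt, hq', ← MvPolynomial.ker_map]
    rfl
  rw [hext, show idealHt P = Order.height P' from idealHt_asIdeal P', h, hp', idealHt_asIdeal]
end
end
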